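/- Let B be a pentagonal fragment of a fullerene graph with γ(B) ≥ 2. Then B is not extremal. -/

import Mathlib

namespace FG

/-- A combinatorial plane (spherically embedded) graph: a finite simple graph together with
its collection of faces, each face recorded as the finset of edges of its boundary cycle.
Every face boundary is a cycle, every edge lies on exactly two faces, and Euler's formula
holds (edges are counted via the face incidences). -/
structure PlaneGraph (V : Type) [Fintype V] [DecidableEq V] : Type where
  graph : SimpleGraph V
  faces : Finset (Finset (Sym2 V))
  face_edges : ∀ f ∈ faces, ∀ e ∈ f, e ∈ graph.edgeSet
  face_cycle : ∀ f ∈ faces, ∃ (v : V) (c : graph.Walk v v), c.IsCycle ∧ c.edges.toFinset = f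
  edge_faces : ∀ e ∈ graph.edgeSet, (faces.filter (fun f => e ∈ f)).card = 2
  euler : 2 * (Fintype.card V + faces.card) = (∑ f ∈ faces, f.card) + 4

variable {V : Type} [Fintype V] [DecidableEq V]

/-- The vertices incident with at least one edge of an edge set. -/
def edgeVerts (E : Finset (Sym2 V)) : Finset V :=
  Finset.univ.filter fun v => ∃ e ∈ E, v ∈ e

/-- The degree of a vertex in the subgraph spanned by an edge set. -/
def deg (E : Finset (Sym2 V)) (v : V) : ℕ := (E.filter fun e => v ∈ e).card

/-- The vertices covered by a collection of faces. -/
def facesVerts (H : Finset (Finset (Sym2 V))) : Finset V := edgeVerts (H.sup id)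

/-- An edge set is a matching: non-loop edges, pairwise vertex-disjoint. -/
def IsMatching (M : Finset (Sym2 V)) : Prop :=
  (∀ e ∈ M, ¬e.IsDiag) ∧ ∀ e ∈ M, ∀ e' ∈ M, e ≠ e' → ∀ v : V, v ∈ e → v ∉ e'

/-- A fullerene graph: a cubic 3-connected plane graph with (exactly 12) pentagonal
faces and hexagonal faces. -/
structure IsFullerene (P : PlaneGraph V) : Prop where
  cubic : ∀ v : V, (P.graph.neighborSet v).ncard = 3
  threeConnected : ∀ s : Set V, s.ncard ≤ 2 → (SimpleGraph.induce sᶜ P.graph).Connected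
  faceSize : ∀ f ∈ P.faces, f.card = 5 ∨ f.card = 6
  pentTwelve : (P.faces.filter fun f => f.card = 5).card = 12

/-- A fragment of a plane graph: a nonempty set of faces (a cycle together with its
interior) whose boundary — the set of edges lying on exactly one chosen face — is a
single cycle. -/
structure Fragment (P : PlaneGraph V) : Type where
  inFaces : Finset (Finset (Sym2 V))
  nonempty : inFaces.Nonempty
  subFaces : inFaces ⊆ P.faces
  boundary_cycle : ∃ (v : V) (c : P.graph.Walk v v), c.IsCycle ∧
    c.edges.toFinset =
      (inFaces.sup id).filter fun e => (inFaces.filter fun f => e ∈ f).card = 1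

/-- The edge set of a fragment. -/
def Fragment.edges {P : PlaneGraph V} (B : Fragment P) : Finset (Sym2 V) := B.inFaces.sup id

/-- The boundary edges of a fragment. -/
def Fragment.boundary {P : PlaneGraph V} (B : Fragment P) : Finset (Sym2 V) :=
  B.edges.filter fun e => (B.inFaces.filter fun f => e ∈ f).card = 1

/-- A pentagonal fragment: all inner faces are pentagons. -/
def IsPentagonalFragment {P : PlaneGraph V} (B : Fragment P) : Prop :=
  ∀ f ∈ B.inFaces, f.card = 5

/-- The faces of `P` adjoining the subgraph with edge set `E`: not a face of the
subgraph, but sharing at least one edge with it. -/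
def adjoiningFaces (P : PlaneGraph V) (E : Finset (Sym2 V)) : Finset (Finset (Sym2 V)) :=
  P.faces.filter fun f => ¬f ⊆ E ∧ (f ∩ E).Nonempty

/-- The territory `T[G]` of the subgraph with edge set `E`: the subgraph together with
all adjoining faces. -/
def territoryEdges (P : PlaneGraph V) (E : Finset (Sym2 V)) : Finset (Sym2 V) :=
  E ∪ (adjoiningFaces P E).sup id

/-- `w(G)`: the number of 2-degree vertices of the subgraph spanned by `E`. -/
def wcount (E : Finset (Sym2 V)) : ℕ := ((edgeVerts E).filter fun v => deg E v = 2).card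

/-- A subgraph is maximal in `P` when its hexagon extension is contained in `P`,
i.e. every adjoining face is a hexagon. -/
def IsMaximalIn (P : PlaneGraph V) (E : Finset (Sym2 V)) : Prop :=
  ∀ f ∈ adjoiningFaces P E, f.card = 6

/-- `H ∈ 𝒮(G)` for the subgraph `G` with edge set `E`: `H` is a set of mutually disjoint
hexagons of the hexagon extension `H[G]` (hexagonal faces sharing at least one edge with
`G`) such that `G − H` has a matching covering all remaining 3-degree vertices of `G`. -/
def SextetAdm (P : PlaneGraph V) (E : Finset (Sym2 V)) (H : Finset (Finset (Sym2 V))) : Prop :=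
  (∀ f ∈ H, f ∈ P.faces ∧ f.card = 6 ∧ (f ∩ E).Nonempty) ∧
  (∀ f ∈ H, ∀ g ∈ H, f ≠ g → Disjoint (edgeVerts f) (edgeVerts g)) ∧
  ∃ M : Finset (Sym2 V), M ⊆ E ∧ IsMatching M ∧
    (∀ e ∈ M, ∀ v : V, v ∈ e → v ∉ facesVerts H) ∧
    ∀ v ∈ edgeVerts E, deg E v = 3 → v ∉ facesVerts H → ∃ e ∈ M, v ∈ e

/-- `U_H(G) = V(G) ∖ V(H)`. -/
def Uset (E : Finset (Sym2 V)) (H : Finset (Finset (Sym2 V))) : Finset V :=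
  edgeVerts E \ facesVerts H

/-- A Clar set of `H[G]`: a member of `𝒮(G)` minimizing `|U_H(G)|`. -/
def IsClarSet (P : PlaneGraph V) (E : Finset (Sym2 V)) (H : Finset (Finset (Sym2 V))) : Prop :=
  SextetAdm P E H ∧ ∀ H', SextetAdm P E H' → (Uset E H).card ≤ (Uset E H').card

/-- A normal Clar set: a Clar set such that `G − H` has a perfect matching. -/
def IsNormalClarSet (P : PlaneGraph V) (E : Finset (Sym2 V))
    (H : Finset (Finset (Sym2 V))) : Prop :=
  IsClarSet P E H ∧ ∃ M : Finset (Sym2 V), M ⊆ E ∧ IsMatching M ∧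
    (∀ e ∈ M, ∀ v : V, v ∈ e → v ∉ facesVerts H) ∧
    ∀ v ∈ Uset E H, ∃ e ∈ M, v ∈ e

/-- The pentagonal faces of the subgraph with edge set `E`. -/
def pentFaces (P : PlaneGraph V) (E : Finset (Sym2 V)) : Finset (Finset (Sym2 V)) :=
  P.faces.filter fun f => f.card = 5 ∧ f ⊆ E

/-- A subgraph with `k` pentagons is extremal if `|U_H(G)| = k` for a Clar set `H`. -/
def IsExtremalSub (P : PlaneGraph V) (E : Finset (Sym2 V)) : Prop :=
  ∃ H, IsClarSet P E H ∧ (Uset E H).card = (pentFaces P E).card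

/-- A pentagonal ring `R_k`: `k` pentagonal faces `R 0, …, R (k-1)` such that
`R i` and `R j` intersect iff `|i − j| = 1 (mod k)`. -/
def IsPentRing (P : PlaneGraph V) (k : ℕ) (R : ZMod k → Finset (Sym2 V)) : Prop :=
  Function.Injective R ∧ (∀ i, R i ∈ P.faces ∧ (R i).card = 5) ∧
  ∀ i j : ZMod k, i ≠ j →
    ((edgeVerts (R i) ∩ edgeVerts (R j)).Nonempty ↔ (j = i + 1 ∨ i = j + 1))

/-- The number of pentagons of the pentagonal fragment `B` adjoining (sharing an edge
with) the pentagon `p`. -/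
def pentAdjCount {P : PlaneGraph V} (B : Fragment P) (p : Finset (Sym2 V)) : ℕ :=
  (B.inFaces.filter fun q => q ≠ p ∧ (q ∩ p).Nonempty).card

/-- The fragment consisting of a single pentagon `P`. -/
def IsPentagonFrag {P : PlaneGraph V} (B : Fragment P) : Prop :=
  IsPentagonalFragment B ∧ B.inFaces.card = 1

/-- `B_2`: the extremal pentagonal fragment with 4 pentagons whose Clar extension is
normal. -/
def IsB2Frag {P : PlaneGraph V} (B : Fragment P) : Prop :=
  IsPentagonalFragment B ∧ B.inFaces.card = 4 ∧ IsExtremalSub P B.edges ∧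
    ∃ H, IsNormalClarSet P B.edges H

/-- `B_3`: the extremal pentagonal fragment with 6 pentagons whose Clar extension is
normal. -/
def IsB3Frag {P : PlaneGraph V} (B : Fragment P) : Prop :=
  IsPentagonalFragment B ∧ B.inFaces.card = 6 ∧ IsExtremalSub P B.edges ∧
    ∃ H, IsNormalClarSet P B.edges H

/-- A pasting edge of the subgraph with edge set `E`: an edge of `E` lying on the
boundary of the Clar extension `C[G]` (not an edge of a Clar hexagon) whose two
end-vertices belong to `V(H)` for a Clar set `H`. -/
def IsPastingEdge (P : PlaneGraph V) (E : Finset (Sym2 V)) (e : Sym2 V) : Prop :=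
  e ∈ E ∧ ∃ H, IsClarSet P E H ∧ (∀ v : V, v ∈ e → v ∈ facesVerts H) ∧ e ∉ H.sup id

/-- `B` arises from pasting `A` and `C` along a common pasting edge:
`B = A ∪ C` and `A ∩ C` is a single pasting edge of both. -/
def IsPasting {P : PlaneGraph V} (B A C : Fragment P) : Prop :=
  B.inFaces = A.inFaces ∪ C.inFaces ∧
  ∃ e : Sym2 V, A.edges ∩ C.edges = {e} ∧ IsPastingEdge P A.edges e ∧ IsPastingEdge P C.edges e

def IsBasicFrag {P : PlaneGraph V} (B : Fragment P) : Prop :=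
  IsPentagonFrag B ∨ IsB2Frag B ∨ IsB3Frag B

/-- The pentagonal fragments generated from `P`, `B_2`, `B_3` by the pasting operation. -/
inductive Pasted (P : PlaneGraph V) : Fragment P → Prop
  | base (B : Fragment P) : IsBasicFrag B → Pasted P B
  | paste (B A C : Fragment P) : Pasted P A → IsBasicFrag C → IsPasting B A C → Pasted P B

/-- `P ∗ P`. -/
def IsPPFrag {P : PlaneGraph V} (B : Fragment P) : Prop :=
  ∃ A C : Fragment P, IsPentagonFrag A ∧ IsPentagonFrag C ∧ IsPasting B A C

/-- `P ∗ B_2`. -/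
def IsPB2Frag {P : PlaneGraph V} (B : Fragment P) : Prop :=
  ∃ A C : Fragment P, IsPentagonFrag A ∧ IsB2Frag C ∧ IsPasting B A C

/-- `P ∗ B_2 ∗ P`. -/
def IsPB2PFrag {P : PlaneGraph V} (B : Fragment P) : Prop :=
  ∃ B' A C D : Fragment P, IsPentagonFrag A ∧ IsB2Frag C ∧ IsPentagonFrag D ∧
    IsPasting B' A C ∧ IsPasting B B' D

/-- The six members of `𝓑_{≥60}`. -/
def SixShapes {P : PlaneGraph V} (B : Fragment P) : Prop :=
  IsPentagonFrag B ∨ IsB2Frag B ∨ IsB3Frag B ∨ IsPPFrag B ∨ IsPB2Frag B ∨ IsPB2PFrag B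

/-- `B_1`: two vertex-disjoint pentagons joined by an edge. -/
def IsB1 (P : PlaneGraph V) (E : Finset (Sym2 V)) : Prop :=
  ∃ (f g : Finset (Sym2 V)) (a b : V), f ∈ P.faces ∧ g ∈ P.faces ∧ f.card = 5 ∧ g.card = 5 ∧
    Disjoint (edgeVerts f) (edgeVerts g) ∧ P.graph.Adj a b ∧
    a ∈ edgeVerts f ∧ b ∈ edgeVerts g ∧ E = f ∪ g ∪ {s(a, b)}

/-- `B_1^k`: `k` copies of `B_1` pasted together along pasting edges of their pentagons. -/
inductive B1Pow (P : PlaneGraph V) : ℕ → Finset (Sym2 V) → Prop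
  | one (E : Finset (Sym2 V)) : IsB1 P E → B1Pow P 1 E
  | succ (k : ℕ) (E X : Finset (Sym2 V)) (e : Sym2 V) (f g : Finset (Sym2 V)) :
      B1Pow P k E → IsB1 P X → E ∩ X = {e} → f ∈ P.faces → g ∈ P.faces →
      f.card = 5 → g.card = 5 → f ⊆ E → g ⊆ X → e ∈ f → e ∈ g →
      IsPastingEdge P f e → IsPastingEdge P g e → B1Pow P (k + 1) (E ∪ X)

/-- `F` contains `B_1^k` for some `2 ≤ k ≤ 4` as a subgraph. -/
def ContainsB1Pow (P : PlaneGraph V) : Prop :=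
  ∃ (k : ℕ) (E : Finset (Sym2 V)), 2 ≤ k ∧ k ≤ 4 ∧ B1Pow P k E

/-- A perfect matching of the plane graph `P`. -/
def IsPerfectMatching (P : PlaneGraph V) (M : Finset (Sym2 V)) : Prop :=
  (∀ e ∈ M, e ∈ P.graph.edgeSet) ∧ IsMatching M ∧ ∀ v : V, ∃ e ∈ M, v ∈ e

/-- A sextet pattern of `P`: mutually disjoint hexagonal faces, all alternating with
respect to a common perfect matching. -/
def IsSextetPattern (P : PlaneGraph V) (H : Finset (Finset (Sym2 V))) : Prop :=
  (∀ f ∈ H, f ∈ P.faces ∧ f.card = 6) ∧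
  (∀ f ∈ H, ∀ g ∈ H, f ≠ g → Disjoint (edgeVerts f) (edgeVerts g)) ∧
  ∃ M : Finset (Sym2 V), IsPerfectMatching P M ∧ ∀ f ∈ H, (f ∩ M).card = 3

/-- A Clar formula: a maximum sextet pattern. -/
def IsClarFormula (P : PlaneGraph V) (H : Finset (Finset (Sym2 V))) : Prop :=
  IsSextetPattern P H ∧ ∀ H', IsSextetPattern P H' → H'.card ≤ H.card

/-- An extremal fullerene graph: the Clar number equals `(n − 12)/6`. -/
def IsExtremalFullerene (P : PlaneGraph V) : Prop :=
  ∃ H, IsClarFormula P H ∧ 6 * H.card = Fintype.card V - 12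

/-- The edges of the union of all maximal pentagonal fragments of `P`. -/
noncomputable def maxPentEdges (P : PlaneGraph V) : Finset (Sym2 V) :=
  @Finset.filter _
    (fun e => ∃ B : Fragment P, IsPentagonalFragment B ∧ IsMaximalIn P B.edges ∧ e ∈ B.edges)
    (Classical.decPred _) (P.faces.sup id)

/-- The disjoint union of two copies of `K_2`. -/
def twoK2 : SimpleGraph (Fin 4) := SimpleGraph.fromEdgeSet {s(0, 1), s(2, 3)}

/-- The tree `T_0` on six vertices: two adjacent 3-degree vertices, each also adjacent
to two leaves. -/
def treeT0 : SimpleGraph (Fin 6) :=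
  SimpleGraph.fromEdgeSet {s(0, 1), s(0, 2), s(0, 3), s(1, 4), s(1, 5)}


set_option linter.unusedSectionVars false

section Aux

theorem mem_edgeVerts {E : Finset (Sym2 V)} {v : V} :
    v ∈ edgeVerts E ↔ ∃ e ∈ E, v ∈ e := by simp [edgeVerts]

theorem mem_facesVerts {H : Finset (Finset (Sym2 V))} {v : V} :
    v ∈ facesVerts H ↔ ∃ h ∈ H, v ∈ edgeVerts h := by
  simp only [facesVerts, mem_edgeVerts, Finset.mem_sup, id]
  constructor
  · rintro ⟨e, ⟨h, hh, he⟩, hv⟩; exact ⟨h, hh, e, he, hv⟩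
  · rintro ⟨h, hh, e, he, hv⟩; exact ⟨e, ⟨h, hh, he⟩, hv⟩

theorem mem_edgeVerts_left {E : Finset (Sym2 V)} {v x : V} (h : s(v, x) ∈ E) :
    v ∈ edgeVerts E := mem_edgeVerts.2 ⟨_, h, Sym2.mem_mk_left _ _⟩

theorem exists_edge {E : Finset (Sym2 V)} {v : V} (h : v ∈ edgeVerts E) :
    ∃ x, s(v, x) ∈ E := by
  obtain ⟨e, he, hv⟩ := mem_edgeVerts.1 h
  obtain ⟨x, rfl⟩ := hv
  exact ⟨x, he⟩

/-- Every face passes through each of its vertices with exactly two edges. -/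
theorem face_deg (P : PlaneGraph V) {f : Finset (Sym2 V)} (hf : f ∈ P.faces) {v : V}
    (hv : v ∈ edgeVerts f) : ∃ a b, a ≠ b ∧ ∀ x, s(v, x) ∈ f ↔ x = a ∨ x = b := by
  obtain ⟨u, c, hc, rfl⟩ := P.face_cycle f hf
  obtain ⟨y, hy⟩ := exists_edge hv
  have hy' : s(v, y) ∈ c.edges := by simpa using hy
  have hs : v ∈ c.support := c.fst_mem_support_of_mem_edges hy'
  have h2 := hc.ncard_neighborSet_toSubgraph_eq_two hs
  obtain ⟨a, b, hab, h⟩ := Set.ncard_eq_two.1 h2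
  refine ⟨a, b, hab, fun x => ?_⟩
  have : x ∈ c.toSubgraph.neighborSet v ↔ x ∈ ({a, b} : Set V) := by rw [h]
  simp only [SimpleGraph.Subgraph.mem_neighborSet, Set.mem_insert_iff,
    Set.mem_singleton_iff] at this
  rw [← this, ← SimpleGraph.Subgraph.mem_edgeSet, SimpleGraph.Walk.mem_edges_toSubgraph]
  simp

theorem face_adj (P : PlaneGraph V) {f : Finset (Sym2 V)} (hf : f ∈ P.faces) {v x : V}
    (h : s(v, x) ∈ f) : P.graph.Adj v x := by
  simpa using P.face_edges f hf _ h

/-- The other face at an edge. -/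
theorem other_face (P : PlaneGraph V) {f : Finset (Sym2 V)} (hf : f ∈ P.faces) {e : Sym2 V}
    (he : e ∈ f) : ∃ g ∈ P.faces, g ≠ f ∧ e ∈ g ∧ ∀ k ∈ P.faces, e ∈ k → k = f ∨ k = g := by
  have h2 := P.edge_faces e (P.face_edges f hf e he)
  obtain ⟨x, y, hxy, h⟩ := Finset.card_eq_two.1 h2
  have key : ∀ k, (k ∈ P.faces ∧ e ∈ k) ↔ k = x ∨ k = y := fun k => by
    have : k ∈ P.faces.filter (fun f => e ∈ f) ↔ k ∈ ({x, y} : Finset _) := by rw [h]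
    simpa using this
  rcases (key f).1 ⟨hf, he⟩ with rfl | rfl
  · obtain ⟨h1, h3⟩ := (key y).2 (Or.inr rfl)
    exact ⟨y, h1, hxy.symm, h3, fun k hk hek => (key k).1 ⟨hk, hek⟩⟩
  · obtain ⟨h1, h3⟩ := (key x).2 (Or.inl rfl)
    exact ⟨x, h1, hxy, h3, fun k hk hek => ((key k).1 ⟨hk, hek⟩).symm⟩

/-- The local structure at a corner `a v b` of a face `p`. -/
structure Corner (P : PlaneGraph V) (p : Finset (Sym2 V)) (a v b c : V)
    (q r : Finset (Sym2 V)) : Prop where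
  adj : P.graph.Adj v c
  ca : c ≠ a
  cb : c ≠ b
  nbr : ∀ x, P.graph.Adj v x → x = a ∨ x = b ∨ x = c
  hp : p ∈ P.faces
  hq : q ∈ P.faces
  hr : r ∈ P.faces
  ap : s(v, a) ∈ p
  bp : s(v, b) ∈ p
  cp : s(v, c) ∉ p
  aq : s(v, a) ∈ q
  bq : s(v, b) ∉ q
  cq : s(v, c) ∈ q
  ar : s(v, a) ∉ r
  br : s(v, b) ∈ r
  cr : s(v, c) ∈ r
  all : ∀ f ∈ P.faces, v ∈ edgeVerts f → f = p ∨ f = q ∨ f = r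

theorem exists_corner (P : PlaneGraph V) (hP : IsFullerene P) {p : Finset (Sym2 V)}
    (hp : p ∈ P.faces) {a v b : V} (hab : a ≠ b) (ha : s(v, a) ∈ p) (hb : s(v, b) ∈ p) :
    ∃ c q r, Corner P p a v b c q r := by
  have h3 := hP.cubic v
  have hfin : (P.graph.neighborSet v).Finite := Set.toFinite _
  obtain ⟨c, hcadj, hca, hcb, hall⟩ : ∃ c, P.graph.Adj v c ∧ c ≠ a ∧ c ≠ b ∧
      ∀ x, P.graph.Adj v x → x = a ∨ x = b ∨ x = c := by
    obtain ⟨x, y, z, hxy, hxz, hyz, h⟩ := Set.ncard_eq_three.1 h3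
    have key : ∀ w, P.graph.Adj v w ↔ w = x ∨ w = y ∨ w = z := fun w => by
      have : w ∈ P.graph.neighborSet v ↔ w ∈ ({x, y, z} : Set V) := by rw [h]
      simpa using this
    have h1 := (key a).1 (face_adj P hp ha)
    have h2 := (key b).1 (face_adj P hp hb)
    simp only [key]
    rcases h1 with rfl | rfl | rfl <;> rcases h2 with rfl | rfl | rfl <;>
      first
      | exact absurd rfl hab
      | exact ⟨x, by grind⟩
      | exact ⟨y, by grind⟩
      | exact ⟨z, by grind⟩
  have two : ∀ f ∈ P.faces, v ∈ edgeVerts f →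
      (s(v, a) ∈ f ∧ s(v, b) ∈ f ∧ s(v, c) ∉ f) ∨ (s(v, a) ∈ f ∧ s(v, b) ∉ f ∧ s(v, c) ∈ f) ∨
      (s(v, a) ∉ f ∧ s(v, b) ∈ f ∧ s(v, c) ∈ f) := by
    intro f hf hv
    obtain ⟨x, y, hxy, h⟩ := face_deg P hf hv
    have hx := hall x (face_adj P hf ((h x).2 (Or.inl rfl)))
    have hy := hall y (face_adj P hf ((h y).2 (Or.inr rfl)))
    simp only [h]
    grind
  obtain ⟨q, hq, hqp, haq, hqall⟩ := other_face P hp ha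
  obtain ⟨r, hr, hrp, hbr, hrall⟩ := other_face P hp hb
  have hpt := two p hp (mem_edgeVerts_left ha)
  have hqt := two q hq (mem_edgeVerts_left haq)
  have hrt := two r hr (mem_edgeVerts_left hbr)
  -- a face through `v c`
  have hcf : ∃ f ∈ P.faces, s(v, c) ∈ f := by
    have h2 := P.edge_faces s(v, c) (by simpa using hcadj)
    have : (P.faces.filter (fun f => s(v, c) ∈ f)).Nonempty := by
      rw [← Finset.card_pos]; omega
    obtain ⟨f, hf⟩ := this
    exact ⟨f, by simpa using hf⟩
  obtain ⟨g, hg, hcg⟩ := hcf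
  have hgt := two g hg (mem_edgeVerts_left hcg)
  have hqr : q ≠ r := by
    rintro rfl
    have h1 := hqall g hg
    have h2 := hrall g hg
    clear hall h3 two
    grind
  have hbq : s(v, b) ∉ q := fun h => by
    rcases hrall q hq h with h | h
    · exact hqp h
    · exact hqr h
  have har : s(v, a) ∉ r := fun h => by
    rcases hqall r hr h with h | h
    · exact hrp h
    · exact hqr h.symm
  have hcp : s(v, c) ∉ p := by
    rcases hpt with h | h | h
    · exact h.2.2
    · exact absurd hb h.2.1
    · exact absurd ha h.1
  have hcq : s(v, c) ∈ q := by
    rcases hqt with h | h | h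
    · exact absurd h.2.1 hbq
    · exact h.2.2
    · exact h.2.2
  have hcr : s(v, c) ∈ r := by
    rcases hrt with h | h | h
    · exact absurd h.1 har
    · exact h.2.2
    · exact h.2.2
  have hfin : ∀ f ∈ P.faces, v ∈ edgeVerts f → f = p ∨ f = q ∨ f = r := by
    intro f hf hv
    rcases two f hf hv with h | h | h
    · exact (hqall f hf h.1).imp_right Or.inl
    · exact (hqall f hf h.1).imp_right Or.inl
    · exact (hrall f hf h.2.1).imp_right Or.inr
  exact ⟨c, q, r, hcadj, hca, hcb, hall, hp, hq, hr, ha, hb, hcp, haq, hbq, hcq,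
    har, hbr, hcr, hfin⟩

/-- A labelled pentagon. -/
def Pent (p : Finset (Sym2 V)) (a b c d e : V) : Prop :=
  [a, b, c, d, e].Nodup ∧ p = {s(a, b), s(b, c), s(c, d), s(d, e), s(e, a)}

theorem Pent.rot {p : Finset (Sym2 V)} {a b c d e : V} (h : Pent p a b c d e) :
    Pent p b c d e a := by
  obtain ⟨h1, h2⟩ := h
  refine ⟨by simp at h1 ⊢; grind, ?_⟩
  rw [h2]; ext x; simp; tauto

theorem Pent.refl {p : Finset (Sym2 V)} {a b c d e : V} (h : Pent p a b c d e) :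
    Pent p a e d c b := by
  obtain ⟨h1, h2⟩ := h
  refine ⟨by simp at h1 ⊢; grind, ?_⟩
  rw [h2, Sym2.eq_swap (a := a) (b := e), Sym2.eq_swap (a := e) (b := d),
    Sym2.eq_swap (a := d) (b := c), Sym2.eq_swap (a := c) (b := b),
    Sym2.eq_swap (a := b) (b := a)]
  ext x; simp; tauto

theorem exists_pent (P : PlaneGraph V) {p : Finset (Sym2 V)} (hp : p ∈ P.faces)
    (h5 : p.card = 5) : ∃ a b c d e, Pent p a b c d e := by
  obtain ⟨u, c, hc, rfl⟩ := P.face_cycle p hp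
  rw [List.toFinset_card_of_nodup hc.edges_nodup, SimpleGraph.Walk.length_edges] at h5
  have hn := hc.support_nodup
  rcases c with _ | ⟨h1, _ | ⟨h2, _ | ⟨h3, _ | ⟨h4, _ | ⟨h5, _ | ⟨h6, c⟩⟩⟩⟩⟩⟩ <;> simp at h5
  rename_i a b c d _
  refine ⟨u, a, b, c, d, ?_, ?_⟩
  · simp at hn ⊢; grind
  · ext x; simp

theorem Pent.mem_verts {p : Finset (Sym2 V)} {a b c d e v : V} (h : Pent p a b c d e) :
    v ∈ edgeVerts p ↔ v = a ∨ v = b ∨ v = c ∨ v = d ∨ v = e := by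
  rw [mem_edgeVerts, h.2]; simp; tauto

theorem Pent.edge {p : Finset (Sym2 V)} {a b c d e : V} (h : Pent p a b c d e) :
    s(a, b) ∈ p := by rw [h.2]; simp

theorem Pent.edge_iff {p : Finset (Sym2 V)} {a b c d e x : V} (h : Pent p a b c d e) :
    s(a, x) ∈ p ↔ x = b ∨ x = e := by
  obtain ⟨h1, rfl⟩ := h
  simp at h1 ⊢
  grind

/-- Labelling of a pentagon starting with two given consecutive edges `a v b`. -/
theorem exists_pent_at (P : PlaneGraph V) {p : Finset (Sym2 V)} (hp : p ∈ P.faces)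
    (h5 : p.card = 5) {a v b : V} (hab : a ≠ b) (ha : s(v, a) ∈ p) (hb : s(v, b) ∈ p) :
    ∃ d e, Pent p a v b d e := by
  obtain ⟨x0, x1, x2, x3, x4, h⟩ := exists_pent P hp h5
  obtain ⟨y0, y1, y2, y3, h⟩ : ∃ y0 y1 y2 y3, Pent p v y0 y1 y2 y3 := by
    have hv := mem_edgeVerts_left ha
    rw [h.mem_verts] at hv
    rcases hv with rfl | rfl | rfl | rfl | rfl
    · exact ⟨_, _, _, _, h⟩
    · exact ⟨_, _, _, _, h.rot⟩
    · exact ⟨_, _, _, _, h.rot.rot⟩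
    · exact ⟨_, _, _, _, h.rot.rot.rot⟩
    · exact ⟨_, _, _, _, h.rot.rot.rot.rot⟩
  rw [h.edge_iff] at ha hb
  rcases ha with rfl | rfl <;> rcases hb with rfl | rfl
  · exact absurd rfl hab
  · exact ⟨_, _, h.refl.rot.rot.rot.rot⟩
  · exact ⟨_, _, h.rot.rot.rot.rot⟩
  · exact absurd rfl hab

end Aux
section Local

/-- The local data of the problem: a set `S` of pentagons, a set `H` of disjoint hexagons and
a matching `M` covering all uncovered vertices lying on two pentagons of `S`. -/
structure Cfg (P : PlaneGraph V) (S H : Finset (Finset (Sym2 V))) (M : Finset (Sym2 V)) :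
    Prop where
  full : IsFullerene P
  sf : ∀ p ∈ S, p ∈ P.faces
  s5 : ∀ p ∈ S, p.card = 5
  hf : ∀ h ∈ H, h ∈ P.faces
  h6 : ∀ h ∈ H, h.card = 6
  dis : ∀ f ∈ H, ∀ g ∈ H, f ≠ g → Disjoint (edgeVerts f) (edgeVerts g)
  mat : IsMatching M
  mg : ∀ e ∈ M, e ∈ P.graph.edgeSet
  mh : ∀ e ∈ M, ∀ v : V, v ∈ e → v ∉ facesVerts H
  cov : ∀ v, v ∉ facesVerts H → ∀ p ∈ S, ∀ q ∈ S, p ≠ q → v ∈ edgeVerts p → v ∈ edgeVerts q →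
    ∃ e ∈ M, v ∈ e

/-- An edge that belongs to the matching or to a hexagon of `H`. -/
def Paired (H : Finset (Finset (Sym2 V))) (M : Finset (Sym2 V)) (e : Sym2 V) : Prop :=
  e ∈ M ∨ ∃ h ∈ H, e ∈ h

/-- The vertex `v` is left over by the face `p`. -/
def Exit (H : Finset (Finset (Sym2 V))) (M : Finset (Sym2 V)) (v : V) (p : Finset (Sym2 V)) :
    Prop :=
  v ∈ edgeVerts p ∧ v ∉ facesVerts H ∧ ∀ m ∈ M, m ∈ p → v ∉ m

variable {P : PlaneGraph V} {S H : Finset (Finset (Sym2 V))} {M : Finset (Sym2 V)}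

theorem cov_of_edge {h : Finset (Sym2 V)} (hh : h ∈ H) {v x : V} (he : s(v, x) ∈ h) :
    v ∈ facesVerts H := mem_facesVerts.2 ⟨h, hh, mem_edgeVerts_left he⟩

theorem cov_of_edge' {h : Finset (Sym2 V)} (hh : h ∈ H) {v x : V} (he : s(x, v) ∈ h) :
    v ∈ facesVerts H := cov_of_edge hh (Sym2.eq_swap (a := x) (b := v) ▸ he)

theorem Cfg.ne_hex (C : Cfg P S H M) {p h : Finset (Sym2 V)} (hp : p ∈ S) (hh : h ∈ H) :
    h ≠ p := by
  rintro rfl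
  have h1 := C.h6 h hh
  have h2 := C.s5 h hp
  omega

theorem mat_unique (C : Cfg P S H M) {e e' : Sym2 V} (he : e ∈ M) (he' : e' ∈ M) {v : V}
    (hv : v ∈ e) (hv' : v ∈ e') : e = e' := by
  by_contra h
  exact C.mat.2 e he e' he' h v hv hv'

theorem mat_unique' (C : Cfg P S H M) {v x y : V} (he : s(v, x) ∈ M) (he' : s(v, y) ∈ M) :
    x = y := by
  have := mat_unique C he he' (Sym2.mem_mk_left _ _) (Sym2.mem_mk_left _ _)
  simp at this
  rcases this with h | ⟨h, h'⟩
  · exact h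
  · exact h'.trans h

theorem Pent.corner (C : Cfg P S H M) {p : Finset (Sym2 V)} (hp : p ∈ S) {a b c d e : V}
    (hpt : Pent p a b c d e) : ∃ x q r, Corner P p a b c x q r := by
  apply exists_corner P C.full (C.sf p hp)
  · have := hpt.1; simp at this; grind
  · rw [Sym2.eq_swap]; exact hpt.edge
  · exact hpt.rot.edge

theorem not_both_paired (C : Cfg P S H M) {p : Finset (Sym2 V)} (hp : p ∈ S) {a b c d e : V}
    (hpt : Pent p a b c d e) : ¬(Paired H M s(a, b) ∧ Paired H M s(b, c)) := by
  have hac : a ≠ c := by have := hpt.1; simp at this; grind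
  rintro ⟨h1 | ⟨h, hh, h1⟩, h2 | ⟨h', hh', h2⟩⟩
  · rw [Sym2.eq_swap] at h1
    exact hac (mat_unique' C h1 h2)
  · exact C.mh _ h1 b (by simp) (cov_of_edge hh' h2)
  · exact C.mh _ h2 b (by simp) (cov_of_edge' hh h1)
  · have hhh : h = h' := by
      by_contra hne
      have := C.dis h hh h' hh' hne
      rw [Sym2.eq_swap] at h1
      exact Finset.disjoint_left.1 this (mem_edgeVerts_left h1) (mem_edgeVerts_left h2)
    subst hhh
    obtain ⟨x, q, r, K⟩ := hpt.corner C hp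
    rw [Sym2.eq_swap] at h1
    rcases K.all h (C.hf h hh) (mem_edgeVerts_left h2) with rfl | rfl | rfl
    · exact C.ne_hex hp hh rfl
    · exact K.bq h2
    · exact K.ar h1

theorem paired_of_cov (C : Cfg P S H M) {p : Finset (Sym2 V)} (hp : p ∈ S) {a b c d e : V}
    (hpt : Pent p a b c d e) (hb : b ∈ facesVerts H) :
    Paired H M s(a, b) ∨ Paired H M s(b, c) := by
  obtain ⟨h, hh, hb⟩ := mem_facesVerts.1 hb
  obtain ⟨x, q, r, K⟩ := hpt.corner C hp
  rcases K.all h (C.hf h hh) hb with rfl | rfl | rfl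
  · exact absurd rfl (C.ne_hex hp hh)
  · left; right; refine ⟨_, hh, ?_⟩; rw [Sym2.eq_swap]; exact K.aq
  · right; right; exact ⟨_, hh, K.br⟩

theorem exit_iff (C : Cfg P S H M) {p : Finset (Sym2 V)} (hp : p ∈ S) {a b c d e : V}
    (hpt : Pent p a b c d e) :
    Exit H M b p ↔ ¬Paired H M s(a, b) ∧ ¬Paired H M s(b, c) := by
  constructor
  · rintro ⟨-, h1, h2⟩
    refine ⟨?_, ?_⟩
    · rintro (h | ⟨h, hh, h3⟩)
      · exact h2 _ h hpt.edge (by simp)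
      · exact h1 (cov_of_edge' hh h3)
    · rintro (h | ⟨h, hh, h3⟩)
      · exact h2 _ h hpt.rot.edge (by simp)
      · exact h1 (cov_of_edge hh h3)
  · rintro ⟨h1, h2⟩
    refine ⟨hpt.mem_verts.2 (by simp), fun h => ?_, fun m hm hmp hbm => ?_⟩
    · exact (paired_of_cov C hp hpt h).elim h1 h2
    · obtain ⟨x, rfl⟩ := hbm
      rcases hpt.rot.edge_iff.1 hmp with rfl | rfl
      · exact h2 (Or.inl hm)
      · exact h1 (Or.inl (by rw [Sym2.eq_swap]; exact hm))

theorem exists_exit (C : Cfg P S H M) {p : Finset (Sym2 V)} (hp : p ∈ S) :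
    ∃ v, Exit H M v p := by
  obtain ⟨a, b, c, d, e, h⟩ := exists_pent P (C.sf p hp) (C.s5 p hp)
  by_contra hn
  push Not at hn
  have n1 := not_both_paired C hp h
  have n2 := not_both_paired C hp h.rot
  have n3 := not_both_paired C hp h.rot.rot
  have n4 := not_both_paired C hp h.rot.rot.rot
  have n5 := not_both_paired C hp h.rot.rot.rot.rot
  have e1 := hn b; rw [exit_iff C hp h] at e1
  have e2 := hn c; rw [exit_iff C hp h.rot] at e2
  have e3 := hn d; rw [exit_iff C hp h.rot.rot] at e3
  have e4 := hn e; rw [exit_iff C hp h.rot.rot.rot] at e4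
  have e5 := hn a; rw [exit_iff C hp h.rot.rot.rot.rot] at e5
  tauto

/-- Two faces at a vertex cover all edges at the vertex. -/
theorem cover_two (hP : IsFullerene P) {p q : Finset (Sym2 V)} (hp : p ∈ P.faces)
    (hq : q ∈ P.faces) (hpq : p ≠ q) {v : V} (hvp : v ∈ edgeVerts p) (hvq : v ∈ edgeVerts q)
    {x : V} (hx : P.graph.Adj v x) : s(v, x) ∈ p ∨ s(v, x) ∈ q := by
  obtain ⟨a, b, hab, h⟩ := face_deg P hp hvp
  obtain ⟨c, q', r', K⟩ := exists_corner P hP hp hab ((h a).2 (Or.inl rfl)) ((h b).2 (Or.inr rfl))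
  have hqq : s(v, c) ∈ q := by
    rcases K.all q hq hvq with rfl | rfl | rfl
    · exact absurd rfl hpq
    · exact K.cq
    · exact K.cr
  rcases K.nbr x hx with rfl | rfl | rfl
  · exact Or.inl K.ap
  · exact Or.inl K.bp
  · exact Or.inr hqq

/-- A vertex is left over by at most one pentagon. -/
theorem exit_unique (C : Cfg P S H M) {p q : Finset (Sym2 V)} (hp : p ∈ S) (hq : q ∈ S) {v : V}
    (h1 : Exit H M v p) (h2 : Exit H M v q) : p = q := by
  by_contra hne
  obtain ⟨e, he, hv⟩ := C.cov v h1.2.1 p hp q hq hne h1.1 h2.1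
  obtain ⟨x, rfl⟩ := hv
  rcases cover_two C.full (C.sf p hp) (C.sf q hq) hne h1.1 h2.1 (by simpa using C.mg _ he) with h | h
  · exact h1.2.2 _ he h (by simp)
  · exact h2.2.2 _ he h (by simp)

/-- The equality case. -/
structure Tight (P : PlaneGraph V) (S H : Finset (Finset (Sym2 V))) (M : Finset (Sym2 V)) :
    Prop extends Cfg P S H M where
  q1 : ∀ p ∈ S, ∀ v w, Exit H M v p → Exit H M w p → v = w
  q2 : ∀ p ∈ S, ∀ v ∈ edgeVerts p, v ∉ facesVerts H → ∃ q ∈ S, Exit H M v q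

theorem tight_of_card (C : Cfg P S H M) (U : Finset V)
    (hU : ∀ p ∈ S, ∀ v ∈ edgeVerts p, v ∉ facesVerts H → v ∈ U) (hc : U.card = S.card) :
    Tight P S H M := by
  have hx : ∀ p : Finset (Sym2 V), ∃ v, p ∈ S → Exit H M v p := fun p => by
    by_cases hp : p ∈ S
    · obtain ⟨v, hv⟩ := exists_exit C hp
      exact ⟨v, fun _ => hv⟩
    · obtain ⟨v⟩ : Nonempty V := by
        have := C.full.threeConnected ∅ (by simp)
        obtain ⟨⟨v, _⟩⟩ := this.nonempty
        exact ⟨v⟩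
      exact ⟨v, fun h => absurd h hp⟩
  choose x hx using hx
  have hinj : Set.InjOn x S := fun p hp q hq hpq =>
    exit_unique C hp hq (hx p hp) (hpq ▸ hx q hq)
  have himg : S.image x = U := by
    apply Finset.eq_of_subset_of_card_le
    · intro v hv
      obtain ⟨p, hp, rfl⟩ := Finset.mem_image.1 hv
      exact hU p hp _ (hx p hp).1 (hx p hp).2.1
    · rw [Finset.card_image_of_injOn hinj, hc]
  have hq2 : ∀ p ∈ S, ∀ v ∈ edgeVerts p, v ∉ facesVerts H → ∃ q ∈ S, v = x q := by
    intro p hp v hv hvH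
    have := hU p hp v hv hvH
    rw [← himg] at this
    obtain ⟨q, hq, rfl⟩ := Finset.mem_image.1 this
    exact ⟨q, hq, rfl⟩
  refine ⟨C, fun p hp v w hv hw => ?_, fun p hp v hv hvH => ?_⟩
  · have key : ∀ v, Exit H M v p → v = x p := fun v hv => by
      obtain ⟨q, hq, rfl⟩ := hq2 p hp v hv.1 hv.2.1
      rw [exit_unique C hp hq hv (hx q hq)]
    rw [key v hv, key w hw]
  · obtain ⟨q, hq, rfl⟩ := hq2 p hp v hv hvH
    exact ⟨q, hq, hx q hq⟩

/-- The two edges of a pentagon paired off next to its exit. -/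
theorem Tight.exit_pairs (T : Tight P S H M) {p : Finset (Sym2 V)} (hp : p ∈ S) {a b c d e : V}
    (h : Pent p a b c d e) (hx : Exit H M a p) :
    Paired H M s(b, c) ∧ Paired H M s(d, e) ∧ ¬Paired H M s(a, b) ∧ ¬Paired H M s(c, d) ∧
      ¬Paired H M s(e, a) := by
  have C := T.toCfg
  have hne := h.1
  simp at hne
  have e1 : ¬Exit H M b p := fun h' => hne.1.1 (T.q1 p hp _ _ hx h')
  have e2 : ¬Exit H M c p := fun h' => hne.1.2.1 (T.q1 p hp _ _ hx h')
  have e3 : ¬Exit H M d p := fun h' => hne.1.2.2.1 (T.q1 p hp _ _ hx h')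
  have e4 : ¬Exit H M e p := fun h' => hne.1.2.2.2 (T.q1 p hp _ _ hx h')
  have n1 := not_both_paired C hp h
  have n2 := not_both_paired C hp h.rot
  have n3 := not_both_paired C hp h.rot.rot
  have n4 := not_both_paired C hp h.rot.rot.rot
  have n5 := not_both_paired C hp h.rot.rot.rot.rot
  rw [exit_iff C hp h] at e1
  rw [exit_iff C hp h.rot] at e2
  rw [exit_iff C hp h.rot.rot] at e3
  rw [exit_iff C hp h.rot.rot.rot] at e4
  rw [exit_iff C hp h.rot.rot.rot.rot] at hx
  clear hne C
  grind

/-- An edge is inner if all faces at it belong to `S`. -/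
def Inner (P : PlaneGraph V) (S : Finset (Finset (Sym2 V))) (e : Sym2 V) : Prop :=
  ∀ f ∈ P.faces, e ∈ f → f ∈ S

/-- In a tight configuration, if `s(b, c)` is a matching edge of the pentagon `p` and
`s(c, d)` is the next edge, then the other face at `s(c, d)` is a pentagon of `S`
with exit `c`. -/
theorem Tight.next (T : Tight P S H M) {p : Finset (Sym2 V)} (hp : p ∈ S) {b c d x y : V}
    (h : Pent p b c d x y) (hm : s(b, c) ∈ M) {q : Finset (Sym2 V)} (hq : q ∈ P.faces)
    (hqp : q ≠ p) (hcd : s(c, d) ∈ q) : q ∈ S ∧ Exit H M c q := by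
  have C := T.toCfg
  have hcH : c ∉ facesVerts H := C.mh _ hm c (by simp)
  obtain ⟨r, hr, hx⟩ := T.q2 p hp c (h.mem_verts.2 (by simp)) hcH
  obtain ⟨z, q', r', K⟩ := h.corner C hp
  have hqr : q = r' := by
    rcases K.all q hq (mem_edgeVerts_left hcd) with rfl | rfl | rfl
    · exact absurd rfl hqp
    · exact absurd hcd K.bq
    · rfl
  have hrr : r = r' := by
    have hm' : s(c, b) ∈ M := by rw [Sym2.eq_swap]; exact hm
    rcases K.all r (C.sf r hr) hx.1 with rfl | rfl | rfl
    · exact absurd (by simp) (hx.2.2 _ hm' K.ap)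
    · exact absurd (by simp) (hx.2.2 _ hm' K.aq)
    · rfl
  subst hqr
  subst hrr
  exact ⟨hr, hx⟩

/-- The two pairs of a pentagon are not both matching edges. -/
theorem Tight.not_both_mat (T : Tight P S H M) {p : Finset (Sym2 V)} (hp : p ∈ S)
    {a b c d e : V} (h : Pent p a b c d e) : ¬(s(b, c) ∈ M ∧ s(d, e) ∈ M) := by
  rintro ⟨h1, h2⟩
  obtain ⟨q, hq, hqp, hcd, -⟩ := other_face P (T.sf p hp) h.rot.rot.edge
  obtain ⟨hqS, hxc⟩ := T.next hp h.rot h1 hq hqp hcd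
  have h' : Pent p e d c b a := h.refl.rot
  obtain ⟨-, hxd⟩ := T.next hp h' (by rw [Sym2.eq_swap]; exact h2) hq hqp
    (by rw [Sym2.eq_swap]; exact hcd)
  have := T.q1 q hqS _ _ hxc hxd
  have hne := h.1
  simp at hne
  grind

/-- Hexagon edges of a pentagon of `S` are not inner. -/
theorem Cfg.not_inner (C : Cfg P S H M) {e : Sym2 V} {h : Finset (Sym2 V)} (hh : h ∈ H)
    (he : e ∈ h) : ¬Inner P S e := fun hi => by
  have h1 := C.s5 h (hi h (C.hf h hh) he)
  have h2 := C.h6 h hh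
  omega

/-- The normal form of a pentagon. -/
theorem Tight.normal (T : Tight P S H M) {p : Finset (Sym2 V)} (hp : p ∈ S) :
    ∃ y c d d' c', Pent p y c d d' c' ∧ Exit H M y p ∧ (∃ h ∈ H, s(c, d) ∈ h) ∧
      Paired H M s(d', c') := by
  have C := T.toCfg
  obtain ⟨y, hy⟩ := exists_exit C hp
  obtain ⟨a, b, hab, hf⟩ := face_deg P (C.sf p hp) hy.1
  obtain ⟨d, e, h⟩ := exists_pent_at P (C.sf p hp) (C.s5 p hp) hab ((hf a).2 (Or.inl rfl))
    ((hf b).2 (Or.inr rfl))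
  have h := h.rot
  obtain ⟨h1, h2, -⟩ := T.exit_pairs hp h hy
  have hn := T.not_both_mat hp h
  by_cases hm : s(b, d) ∈ M
  · have h2' : ∃ h ∈ H, s(e, a) ∈ h := h2.resolve_left fun h => hn ⟨hm, h⟩
    refine ⟨_, _, _, _, _, h.refl, hy, ?_, ?_⟩
    · rw [Sym2.eq_swap]; exact h2'
    · rw [Sym2.eq_swap]; exact h1
  · exact ⟨_, _, _, _, _, h, hy, h1.resolve_left hm, h2⟩

end Local
section Charge

variable {P : PlaneGraph V} {S H : Finset (Finset (Sym2 V))} {M : Finset (Sym2 V)}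

/-- Interior vertices: all faces belong to `S`. -/
def IntV (P : PlaneGraph V) (S : Finset (Finset (Sym2 V))) (v : V) : Prop :=
  ∀ f ∈ P.faces, v ∈ edgeVerts f → f ∈ S

open Classical in
noncomputable def innc (P : PlaneGraph V) (S : Finset (Finset (Sym2 V)))
    (p : Finset (Sym2 V)) : ℕ := (p.filter fun e => Inner P S e).card

open Classical in
noncomputable def intc (P : PlaneGraph V) (S : Finset (Finset (Sym2 V)))
    (p : Finset (Sym2 V)) : ℕ := ((edgeVerts p).filter fun v => IntV P S v).card

noncomputable def charge (P : PlaneGraph V) (S : Finset (Finset (Sym2 V)))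
    (p : Finset (Sym2 V)) : ℤ := 6 + 2 * (intc P S p : ℤ) - 3 * (innc P S p : ℤ)

theorem intV_iff (C : Cfg P S H M) {p : Finset (Sym2 V)} (hp : p ∈ S) {a b c d e : V}
    (h : Pent p a b c d e) : IntV P S b ↔ Inner P S s(a, b) ∧ Inner P S s(b, c) := by
  constructor
  · intro hi
    refine ⟨fun f hf he => hi f hf ?_, fun f hf he => hi f hf (mem_edgeVerts_left he)⟩
    rw [Sym2.eq_swap] at he
    exact mem_edgeVerts_left he
  · rintro ⟨h1, h2⟩ f hf hb
    obtain ⟨x, q, r, K⟩ := h.corner C hp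
    rcases K.all f hf hb with rfl | rfl | rfl
    · exact hp
    · refine h1 _ hf ?_
      rw [Sym2.eq_swap]; exact K.aq
    · exact h2 _ hf K.br

open Classical in
theorem Pent.innc_eq {p : Finset (Sym2 V)} {a b c d e : V}
    (h : Pent p a b c d e) : innc P S p = (if Inner P S s(a, b) then 1 else 0) +
      (if Inner P S s(b, c) then 1 else 0) + (if Inner P S s(c, d) then 1 else 0) +
      (if Inner P S s(d, e) then 1 else 0) + (if Inner P S s(e, a) then 1 else 0) := by
  obtain ⟨h1, rfl⟩ := h
  simp at h1
  rw [innc, Finset.card_filter]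
  rw [Finset.sum_insert, Finset.sum_insert, Finset.sum_insert, Finset.sum_insert,
    Finset.sum_singleton]
  · ring
  all_goals simp; grind

open Classical in
theorem Pent.intc_eq {p : Finset (Sym2 V)} {a b c d e : V}
    (h : Pent p a b c d e) : intc P S p = (if IntV P S a then 1 else 0) +
      (if IntV P S b then 1 else 0) + (if IntV P S c then 1 else 0) +
      (if IntV P S d then 1 else 0) + (if IntV P S e then 1 else 0) := by
  have hv : edgeVerts p = {a, b, c, d, e} := by
    ext v; rw [h.mem_verts]; simp
  have h1 := h.1
  simp at h1
  rw [intc, hv, Finset.card_filter]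
  rw [Finset.sum_insert, Finset.sum_insert, Finset.sum_insert, Finset.sum_insert,
    Finset.sum_singleton]
  · ring
  all_goals simp; grind

open Classical in
theorem Pent.charge_eq (C : Cfg P S H M) {p : Finset (Sym2 V)} (hp : p ∈ S) {a b c d e : V}
    (h : Pent p a b c d e) : charge P S p = 6 + 2 * (
      (if Inner P S s(e, a) ∧ Inner P S s(a, b) then 1 else 0) +
      (if Inner P S s(a, b) ∧ Inner P S s(b, c) then 1 else 0) +
      (if Inner P S s(b, c) ∧ Inner P S s(c, d) then 1 else 0) +
      (if Inner P S s(c, d) ∧ Inner P S s(d, e) then 1 else 0) +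
      (if Inner P S s(d, e) ∧ Inner P S s(e, a) then 1 else 0)) -
      3 * ((if Inner P S s(a, b) then 1 else 0) +
      (if Inner P S s(b, c) then 1 else 0) + (if Inner P S s(c, d) then 1 else 0) +
      (if Inner P S s(d, e) then 1 else 0) + (if Inner P S s(e, a) then 1 else 0)) := by
  rw [charge, h.innc_eq, h.intc_eq, intV_iff C hp h, intV_iff C hp h.rot,
    intV_iff C hp h.rot.rot, intV_iff C hp h.rot.rot.rot, intV_iff C hp h.rot.rot.rot.rot]
  push_cast
  rfl

theorem Tight.inner_next (T : Tight P S H M) {p : Finset (Sym2 V)} (hp : p ∈ S) {b c d x y : V}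
    (h : Pent p b c d x y) (hm : s(b, c) ∈ M) : Inner P S s(c, d) := by
  intro f hf he
  by_cases hfp : f = p
  · exact hfp ▸ hp
  · exact (T.next hp h hm hf hfp he).1

theorem Tight.side (T : Tight P S H M) {r : Finset (Sym2 V)} (hr : r ∈ S) {c y x : V}
    (hcx : c ≠ x) (h1 : s(y, c) ∈ r) (h2 : s(y, x) ∈ r) (hm : s(y, x) ∈ M)
    (hc : c ∈ facesVerts H) : ∃ u u2, Pent r c y x u u2 ∧ Exit H M u r := by
  have C := T.toCfg
  obtain ⟨u, u2, h⟩ := exists_pent_at P (C.sf r hr) (C.s5 r hr) hcx h1 h2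
  refine ⟨u, u2, h, ?_⟩
  have n1 := not_both_paired C hr h
  have n2 := not_both_paired C hr h.rot
  have n4 := not_both_paired C hr h.rot.rot.rot
  have hp : Paired H M s(y, x) := Or.inl hm
  have hx := paired_of_cov C hr h.rot.rot.rot.rot hc
  rw [exit_iff C hr h.rot.rot]
  tauto

/-- The exit of a pentagon with two faces of `S` around it is matched along its third edge. -/
theorem Cfg.third (C : Cfg P S H M) {p : Finset (Sym2 V)} (hp : p ∈ S)
    {a v b c : V} {q r q' : Finset (Sym2 V)} (K : Corner P p a v b c q r) (hx : Exit H M v p)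
    (hq : q' ∈ S) (hqp : q' ≠ p) (hv : v ∈ edgeVerts q') : s(v, c) ∈ M := by
  obtain ⟨e, he, hve⟩ := C.cov v hx.2.1 p hp q' hq hqp.symm hx.1 hv
  obtain ⟨z, rfl⟩ := hve
  rcases K.nbr z (by simpa using C.mg _ he) with rfl | rfl | rfl
  · exact absurd (by simp) (hx.2.2 _ he K.ap)
  · exact absurd (by simp) (hx.2.2 _ he K.bp)
  · exact he

theorem Tight.noE (T : Tight P S H M) {p : Finset (Sym2 V)} (hp : p ∈ S) {y c d d' c' : V}
    (h : Pent p y c d d' c') (hy : Exit H M y p) (hc : c ∈ facesVerts H)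
    (hc' : c' ∈ facesVerts H) (hi : Inner P S s(y, c)) (hi' : Inner P S s(c', y)) : False := by
  have C := T.toCfg
  obtain ⟨x, q, r, K⟩ := h.rot.rot.rot.rot.corner C hp
  have hr : r ∈ S := hi r K.hr K.br
  have hq : q ∈ S := hi' q K.hq (by rw [Sym2.eq_swap]; exact K.aq)
  have hqp : q ≠ p := by rintro rfl; exact K.cp K.cq
  have hqr : q ≠ r := by rintro rfl; exact K.ar K.aq
  have hm := C.third hp K hy hq hqp (mem_edgeVerts_left K.aq)
  obtain ⟨u, u2, hpr, hu⟩ := T.side hr K.cb.symm K.br K.cr hm hc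
  obtain ⟨w, w2, hpq, hw⟩ := T.side hq K.ca.symm K.aq K.cq hm hc'
  obtain ⟨z, hz, hzr, hzu, -⟩ := other_face P (C.sf r hr) hpr.rot.rot.edge
  obtain ⟨z', hz', hzq, hzw, -⟩ := other_face P (C.sf q hq) hpq.rot.rot.edge
  obtain ⟨hzS, hxz⟩ := T.next hr hpr.rot hm hz hzr hzu
  obtain ⟨hzS', hxz'⟩ := T.next hq hpq.rot hm hz' hzq hzw
  have hzz := exit_unique C hzS hzS' hxz hxz'
  subst hzz
  have huw : u ≠ w := by
    rintro rfl
    obtain ⟨t, q1, r1, L⟩ := hpr.rot.corner C hr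
    have e1 : s(x, y) ∈ q := by rw [Sym2.eq_swap]; exact K.cq
    rcases L.all q K.hq (mem_edgeVerts_left e1) with rfl | rfl | rfl
    · exact hqr rfl
    · exact L.bq hpq.rot.rot.edge
    · exact L.ar e1
  obtain ⟨g, g', hpz⟩ := exists_pent_at P hz (C.s5 z hzS) huw hzu hzw
  obtain ⟨h1, h2, -⟩ := T.exit_pairs hzS hpz.rot hxz
  apply T.not_both_mat hzS hpz.rot
  constructor
  · rcases h1 with h1 | ⟨k, hk, h1⟩
    · exact h1
    · exact absurd (cov_of_edge hk h1) hw.2.1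
  · rcases h2 with h1 | ⟨k, hk, h1⟩
    · exact h1
    · exact absurd (cov_of_edge' hk h1) hu.2.1

/-- The relation used for discharging. -/
def Rel (H : Finset (Finset (Sym2 V))) (M : Finset (Sym2 V)) (p q : Finset (Sym2 V)) : Prop :=
  q ≠ p ∧ ∃ u y y', u ≠ y' ∧ Exit H M u q ∧ s(y, u) ∈ p ∧ s(y, u) ∈ q ∧ s(y, y') ∈ M ∧
    s(y, y') ∈ q

theorem Tight.rel_inj (T : Tight P S H M) {p p' q : Finset (Sym2 V)} (hp : p ∈ S) (hp' : p' ∈ S)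
    (hq : q ∈ S) (h : Rel H M p q) (h' : Rel H M p' q) : p = p' := by
  have C := T.toCfg
  obtain ⟨h1, u, y, y', hu, hx, h2, h3, h4, h5⟩ := h
  obtain ⟨h1', v, z, z', hv, hx', h2', h3', h4', h5'⟩ := h'
  obtain rfl := T.q1 q hq _ _ hx hx'
  obtain ⟨a, b, hp1⟩ := exists_pent_at P (C.sf q hq) (C.s5 q hq) hu h3 h5
  by_cases hyz : y = z
  · subst hyz
    obtain ⟨g, hg, hgq, -, hall⟩ := other_face P (C.sf q hq) h3
    have e1 := (hall p (C.sf p hp) h2).resolve_left h1.symm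
    have e2 := (hall p' (C.sf p' hp') h2').resolve_left h1'.symm
    rw [e1, e2]
  · exfalso
    rw [Sym2.eq_swap, hp1.edge_iff] at h3'
    have hzb : z = b := h3'.resolve_left fun h => hyz h.symm
    subst hzb
    have e := hp1.rot.rot.rot.rot.edge_iff.1 h5'
    have hz' : z' = a := e.resolve_left hv.symm
    subst hz'
    exact T.not_both_mat hq hp1 ⟨h4, by rw [Sym2.eq_swap]; exact h4'⟩

theorem Tight.caseC (T : Tight P S H M) {p : Finset (Sym2 V)} (hp : p ∈ S) {y c d d' c' : V}
    (h : Pent p y c d d' c') (hy : Exit H M y p) (hm : s(d', c') ∈ M)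
    (hi : ¬Inner P S s(y, c)) (hi' : Inner P S s(d', c')) :
    ∃ q ∈ S, Rel H M p q ∧ charge P S q = -1 := by
  have C := T.toCfg
  have hpa : Pent p d' c' y c d := h.rot.rot.rot
  have hin : Inner P S s(c', y) := T.inner_next hp hpa hm
  obtain ⟨q, hqf, hqp, hcy, hqall⟩ := other_face P (C.sf p hp) hpa.rot.edge
  obtain ⟨hq, hxq⟩ := T.next hp hpa hm hqf hqp hcy
  obtain ⟨x, q1, r1, K⟩ := hpa.rot.corner C hp
  have hyc : s(y, c') ∈ q := by rw [Sym2.eq_swap]; exact hcy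
  have hqq : q = q1 := by
    rcases K.all q hqf (mem_edgeVerts_left hyc) with rfl | rfl | rfl
    · exact absurd rfl hqp
    · rfl
    · exact absurd hyc K.ar
  subst hqq
  have hmx : s(y, x) ∈ M := C.third hp K hy hq hqp (mem_edgeVerts_left hyc)
  obtain ⟨o, o2, hpq⟩ := exists_pent_at P hqf (C.s5 q hq) K.ca.symm hyc K.cq
  refine ⟨q, hq, ⟨hqp, c', y, x, K.ca.symm, hxq, K.ap, hyc, hmx, K.cq⟩, ?_⟩
  obtain ⟨-, h2, -⟩ := T.exit_pairs hq hpq hxq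
  obtain ⟨k, hk, hok⟩ := h2.resolve_left fun h => T.not_both_mat hq hpq ⟨hmx, h⟩
  have i4 : ¬Inner P S s(o, o2) := C.not_inner hk hok
  have i3 : Inner P S s(x, o) := T.inner_next hq hpq.rot hmx
  have i2 : ¬Inner P S s(y, x) := by
    intro hix
    apply hi
    intro f hf hfe
    rcases K.all f hf (mem_edgeVerts_left hfe) with rfl | rfl | rfl
    · exact hp
    · exact hq
    · exact hix _ hf K.cr
  have i5 : Inner P S s(o2, c') := by
    have hI := (intV_iff C hp hpa).2 ⟨hi', hin⟩
    exact ((intV_iff C hq hpq.rot.rot.rot.rot).1 hI).1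
  rw [hpq.charge_eq C hq]
  simp [hin, i2, i3, i4, i5]

theorem Tight.charge_le (T : Tight P S H M) {p : Finset (Sym2 V)} (hp : p ∈ S)
    (h2 : 2 ≤ innc P S p) :
    charge P S p ≤ 0 ∨ (charge P S p = 1 ∧ ∃ q ∈ S, Rel H M p q ∧ charge P S q = -1) := by
  have C := T.toCfg
  obtain ⟨y, c, d, d', c', h, hy, ⟨k, hk, hcd⟩, hdc⟩ := T.normal hp
  have i2 : ¬Inner P S s(c, d) := C.not_inner hk hcd
  rw [h.innc_eq] at h2
  rcases hdc with hm | ⟨k', hk', hdc⟩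
  · have i5 : Inner P S s(c', y) := T.inner_next hp h.rot.rot.rot hm
    have i3 : Inner P S s(c, d) ∨ Inner P S s(d, d') := by
      right
      have := T.inner_next hp (h.refl.rot) (by rw [Sym2.eq_swap]; exact hm)
      rw [Sym2.eq_swap]; exact this
    replace i3 := i3.resolve_left i2
    by_cases i1 : Inner P S s(y, c)
    · left
      rw [h.charge_eq C hp]
      by_cases i4 : Inner P S s(d', c') <;> simp [i1, i2, i3, i4, i5]
    · by_cases i4 : Inner P S s(d', c')
      · right
        refine ⟨?_, T.caseC hp h hy hm i1 i4⟩
        rw [h.charge_eq C hp]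
        simp [i1, i2, i3, i4, i5]
      · left
        rw [h.charge_eq C hp]
        simp [i1, i2, i3, i4, i5]
  · left
    have i4 : ¬Inner P S s(d', c') := C.not_inner hk' hdc
    have hE := T.noE hp h hy (cov_of_edge hk hcd) (cov_of_edge' hk' hdc)
    rw [h.charge_eq C hp]
    by_cases i1 : Inner P S s(y, c) <;> by_cases i3 : Inner P S s(d, d') <;>
      by_cases i5 : Inner P S s(c', y) <;> simp [i1, i2, i3, i4, i5] at h2 ⊢
    exact hE i1 i5

theorem Tight.sum_charge (T : Tight P S H M) (h2 : ∀ p ∈ S, 2 ≤ innc P S p) :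
    ∑ p ∈ S, charge P S p ≤ 0 := by
  classical
  have key : ∀ p : Finset (Sym2 V), ∃ q, p ∈ S → 0 < charge P S p →
      q ∈ S ∧ Rel H M p q ∧ charge P S q = -1 := by
    intro p
    by_cases hp : p ∈ S
    · rcases T.charge_le hp (h2 p hp) with h | ⟨-, q, hq, h⟩
      · exact ⟨p, fun _ h' => by omega⟩
      · exact ⟨q, fun _ _ => ⟨hq, h⟩⟩
    · exact ⟨p, fun h => absurd h hp⟩
  choose g hg using key
  have hcard : (S.filter fun p => 0 < charge P S p).card ≤
      (S.filter fun p => charge P S p = -1).card := by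
    apply Finset.card_le_card_of_injOn g
    · intro p hp
      simp only [Finset.coe_filter, Set.mem_setOf_eq] at hp ⊢
      obtain ⟨h1, -, h3⟩ := hg p hp.1 hp.2
      exact ⟨h1, h3⟩
    · intro p hp p' hp' hpp
      simp only [Finset.coe_filter, Set.mem_setOf_eq] at hp hp'
      obtain ⟨h1, h2, -⟩ := hg p hp.1 hp.2
      obtain ⟨-, h2', -⟩ := hg p' hp'.1 hp'.2
      rw [← hpp] at h2'
      exact T.rel_inj hp.1 hp'.1 h1 h2 h2'
  have hle : ∑ p ∈ S, charge P S p ≤ ∑ p ∈ S, ((if 0 < charge P S p then (1 : ℤ) else 0) -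
      (if charge P S p = -1 then (1 : ℤ) else 0)) := by
    apply Finset.sum_le_sum
    intro p hp
    rcases T.charge_le hp (h2 p hp) with h | ⟨h, -⟩ <;> split_ifs <;> omega
  refine hle.trans ?_
  rw [Finset.sum_sub_distrib, Finset.sum_boole, Finset.sum_boole]
  have : ((S.filter fun p => 0 < charge P S p).card : ℤ) ≤
      ((S.filter fun p => charge P S p = -1).card : ℤ) := by exact_mod_cast hcard
  linarith

end Charge
section Topology

variable {P : PlaneGraph V}

theorem reach (hP : IsFullerene P) (u v : V) : P.graph.Reachable u v := by
  have h := hP.threeConnected ∅ (by simp)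
  have := h.preconnected ⟨u, by simp⟩ ⟨v, by simp⟩
  exact this.map (SimpleGraph.Embedding.induce (∅ᶜ : Set V)).toHom

theorem const_of_reach {α : Type} (g : V → α) (h : ∀ u v, P.graph.Adj u v → g u = g v) {u v : V}
    (hr : P.graph.Reachable u v) : g u = g v := by
  obtain ⟨w⟩ := hr
  induction w with
  | nil => rfl
  | cons ha _ ih => exact (h _ _ ha).trans ih

theorem const_walk {α : Type} (g : V → α) {u v : V} (c : P.graph.Walk u v)
    (h : ∀ x y, s(x, y) ∈ c.edges → g x = g y) : ∀ w ∈ c.support, g w = g u := by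
  induction c with
  | nil => intro w hw; simp at hw; rw [hw]
  | cons ha p ih =>
    intro w hw
    simp only [SimpleGraph.Walk.support_cons, List.mem_cons] at hw
    rcases hw with rfl | hw
    · rfl
    · rw [ih (fun x y hxy => h x y (by simp [hxy])) w hw]
      exact (h _ _ (by simp)).symm

theorem share_edge (hP : IsFullerene P) {p q : Finset (Sym2 V)} (hp : p ∈ P.faces)
    (hq : q ∈ P.faces) {v : V} (hvp : v ∈ edgeVerts p) (hvq : v ∈ edgeVerts q) :
    ∃ e ∈ p, e ∈ q := by
  obtain ⟨a, b, hab, h⟩ := face_deg P hp hvp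
  obtain ⟨c, q', r', K⟩ := exists_corner P hP hp hab ((h a).2 (Or.inl rfl)) ((h b).2 (Or.inr rfl))
  rcases K.all q hq hvq with rfl | rfl | rfl
  · exact ⟨_, K.ap, K.ap⟩
  · exact ⟨_, K.ap, K.aq⟩
  · exact ⟨_, K.bp, K.br⟩

theorem exists_face {u v : V} (h : P.graph.Adj u v) : ∃ f ∈ P.faces, s(u, v) ∈ f := by
  have h2 := P.edge_faces s(u, v) (by simpa using h)
  have : (P.faces.filter (fun f => s(u, v) ∈ f)).Nonempty := by
    rw [← Finset.card_pos]; omega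
  obtain ⟨f, hf⟩ := this
  exact ⟨f, by simpa using hf⟩

theorem vert_face (hP : IsFullerene P) (v : V) : ∃ f ∈ P.faces, v ∈ edgeVerts f := by
  have h3 := hP.cubic v
  have : (P.graph.neighborSet v).Nonempty := by
    rw [← Set.ncard_pos]; omega
  obtain ⟨x, hx⟩ := this
  obtain ⟨f, hf, h⟩ := exists_face (by simpa using hx : P.graph.Adj v x)
  exact ⟨f, hf, mem_edgeVerts_left h⟩

theorem face_vert {f : Finset (Sym2 V)} (hf : f ∈ P.faces) : ∃ v, v ∈ edgeVerts f := by
  obtain ⟨v, c, hc, rfl⟩ := P.face_cycle f hf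
  have h3 := hc.three_le_length
  rcases c with _ | ⟨h, c⟩
  · simp at h3
  · exact ⟨v, mem_edgeVerts.2 ⟨_, by simp; left; rfl, by simp⟩⟩

/-- Dual connectivity. -/
theorem dual_conn (hP : IsFullerene P) {α : Type} (x : Finset (Sym2 V) → α)
    (hx : ∀ f ∈ P.faces, ∀ g ∈ P.faces, ∀ e ∈ f, e ∈ g → x f = x g) :
    ∀ f ∈ P.faces, ∀ g ∈ P.faces, x f = x g := by
  choose F hF hvF using vert_face hP
  have same : ∀ f ∈ P.faces, ∀ v ∈ edgeVerts f, x f = x (F v) := fun f hf v hv => by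
    obtain ⟨e, h1, h2⟩ := share_edge hP hf (hF v) hv (hvF v)
    exact hx f hf _ (hF v) e h1 h2
  intro f hf g hg
  obtain ⟨u, hu⟩ := face_vert hf
  obtain ⟨v, hv⟩ := face_vert hg
  rw [same f hf u hu, same g hg v hv]
  refine const_of_reach (P := P) (fun v => x (F v)) (fun u v huv => ?_) (reach hP u v)
  obtain ⟨k, hk, he⟩ := exists_face huv
  have he' : s(v, u) ∈ k := by rw [Sym2.eq_swap]; exact he
  exact (same k hk u (mem_edgeVerts_left he)).symm.trans (same k hk v (mem_edgeVerts_left he'))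

/-- A function on vertices equal along the edges of a face is constant on the face. -/
theorem const_face {α : Type} (g : V → α) {f : Finset (Sym2 V)} (hf : f ∈ P.faces)
    (h : ∀ x y, s(x, y) ∈ f → g x = g y) {u v : V} (hu : u ∈ edgeVerts f)
    (hv : v ∈ edgeVerts f) : g u = g v := by
  obtain ⟨w, c, hc, rfl⟩ := P.face_cycle f hf
  have hh := const_walk g c (fun x y hxy => h x y (by simpa using hxy))
  have hs : ∀ z ∈ edgeVerts c.edges.toFinset, z ∈ c.support := fun z hz => by
    obtain ⟨y, hy⟩ := exists_edge hz
    exact c.fst_mem_support_of_mem_edges (by simpa using hy)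
  rw [hh u (hs u hu), hh v (hs v hv)]

/-- Boundary matrices of the complement of a fragment. -/
def D1 (X : Finset V) (Y : Finset (Sym2 V)) : Matrix X Y (ZMod 2) :=
  Matrix.of fun v e => if (v : V) ∈ (e : Sym2 V) then 1 else 0

def D2 (Y : Finset (Sym2 V)) (Z : Finset (Finset (Sym2 V))) : Matrix Y Z (ZMod 2) :=
  Matrix.of fun e f => if (e : Sym2 V) ∈ (f : Finset (Sym2 V)) then 1 else 0

theorem D1_mul_D2 {Z : Finset (Finset (Sym2 V))} (hZ : Z ⊆ P.faces) :
    D1 (facesVerts Z) (Z.sup id) * D2 (Z.sup id) Z = 0 := by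
  ext ⟨v, hv⟩ ⟨f, hf⟩
  rw [Matrix.mul_apply]
  simp only [D1, D2, Matrix.of_apply, Matrix.zero_apply]
  rw [Finset.sum_coe_sort (Z.sup id)
    (fun e => (if v ∈ e then (1 : ZMod 2) else 0) * (if e ∈ f then 1 else 0))]
  have hs : ∑ e ∈ Z.sup id, (if v ∈ e then (1 : ZMod 2) else 0) * (if e ∈ f then 1 else 0) =
      ∑ e ∈ Z.sup id, if e ∈ f ∧ v ∈ e then (1 : ZMod 2) else 0 := by
    apply Finset.sum_congr rfl
    intro e _
    by_cases h1 : v ∈ e <;> by_cases h2 : e ∈ f <;> simp [h1, h2]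
  rw [hs, Finset.sum_boole]
  by_cases hvf : v ∈ edgeVerts f
  · obtain ⟨a, b, hab, h⟩ := face_deg P (hZ hf) hvf
    have : ((Z.sup id).filter fun e => e ∈ f ∧ v ∈ e) = {s(v, a), s(v, b)} := by
      ext e
      simp only [Finset.mem_filter, Finset.mem_sup, id, Finset.mem_insert, Finset.mem_singleton]
      constructor
      · rintro ⟨-, he, x, rfl⟩
        rcases (h x).1 he with rfl | rfl <;> simp
      · rintro (rfl | rfl)
        · exact ⟨⟨f, hf, (h a).2 (Or.inl rfl)⟩, (h a).2 (Or.inl rfl), by simp⟩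
        · exact ⟨⟨f, hf, (h b).2 (Or.inr rfl)⟩, (h b).2 (Or.inr rfl), by simp⟩
    rw [this, Finset.card_pair]
    · rfl
    · simp; grind
  · have : ((Z.sup id).filter fun e => e ∈ f ∧ v ∈ e) = ∅ := by
      ext e
      simp only [Finset.mem_filter, Finset.notMem_empty, iff_false]
      rintro ⟨-, he, h⟩
      exact hvf (mem_edgeVerts.2 ⟨e, he, h⟩)
    rw [this]; rfl

theorem rank_D2 (hP : IsFullerene P) {Z : Finset (Finset (Sym2 V))} (hZ : Z ⊆ P.faces)
    {f0 : Finset (Sym2 V)} (hf0 : f0 ∈ P.faces) (hf0Z : f0 ∉ Z) :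
    (D2 (Z.sup id) Z).rank = Z.card := by
  have hinj : Function.Injective (D2 (Z.sup id) Z).mulVecLin := by
    rw [← LinearMap.ker_eq_bot, LinearMap.ker_eq_bot']
    intro x hx
    let y : Finset (Sym2 V) → ZMod 2 := fun f => if h : f ∈ Z then x ⟨f, h⟩ else 0
    have hy : ∀ f ∈ P.faces, ∀ g ∈ P.faces, ∀ e ∈ f, e ∈ g → y f = y g := by
      intro f hf g hg e hef heg
      by_cases hfg : f = g
      · rw [hfg]
      by_cases hor : f ∈ Z ∨ g ∈ Z
      · have heZ : e ∈ Z.sup id := by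
          rw [Finset.mem_sup]
          rcases hor with h | h
          · exact ⟨f, h, hef⟩
          · exact ⟨g, h, heg⟩
        have h1 := congrFun hx ⟨e, heZ⟩
        simp only [Matrix.mulVecLin_apply, Matrix.mulVec, dotProduct, D2, Matrix.of_apply,
          Pi.zero_apply] at h1
        have h2 : ∑ k ∈ Z, (if e ∈ k then (1 : ZMod 2) else 0) * y k = 0 := by
          refine Eq.trans ?_ h1
          rw [← Finset.sum_coe_sort Z (fun k => (if e ∈ k then (1 : ZMod 2) else 0) * y k)]
          apply Finset.sum_congr rfl
          rintro ⟨k, hk⟩ -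
          simp [y, hk]
        have h3 : ∑ k ∈ P.faces, (if e ∈ k then (1 : ZMod 2) else 0) * y k = 0 := by
          refine Eq.trans (Eq.symm ?_) h2
          apply Finset.sum_subset hZ
          intro k _ hk
          simp [y, hk]
        simp only [ite_mul, one_mul, zero_mul] at h3
        rw [← Finset.sum_filter] at h3
        obtain ⟨g', hg', hg'f, heg', hall⟩ := other_face P hf hef
        have hgg : g = g' := (hall g hg heg).resolve_left fun h => hfg h.symm
        subst hgg
        have : P.faces.filter (fun k => e ∈ k) = {f, g} := by
          ext k
          simp only [Finset.mem_filter, Finset.mem_insert, Finset.mem_singleton]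
          constructor
          · rintro ⟨h1, h2⟩; exact hall k h1 h2
          · rintro (rfl | rfl)
            · exact ⟨hf, hef⟩
            · exact ⟨hg, heg⟩
        rw [this, Finset.sum_pair hfg] at h3
        exact CharTwo.add_eq_zero.1 h3
      · push Not at hor
        simp [y, hor.1, hor.2]
    ext ⟨f, hf⟩
    have := dual_conn hP y hy f (hZ hf) f0 hf0
    simpa [y, hf, hf0Z] using this
  rw [Matrix.rank, LinearMap.finrank_range_of_inj hinj]
  simp

theorem rank_D1 (hP : IsFullerene P) (B : Fragment P) :
    (facesVerts (P.faces \ B.inFaces)).card ≤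
      (D1 (facesVerts (P.faces \ B.inFaces)) ((P.faces \ B.inFaces).sup id)).rank + 1 := by
  set Z := P.faces \ B.inFaces with hZ
  rw [← Matrix.rank_transpose]
  set L := (D1 (facesVerts Z) (Z.sup id)).transpose.mulVecLin with hL
  have hker : Module.finrank (ZMod 2) (LinearMap.ker L) ≤ 1 := by
    obtain ⟨w, c, hc, hce⟩ := B.boundary_cycle
    have hle : LinearMap.ker L ≤ Submodule.span (ZMod 2) {fun _ => 1} := by
      intro b hb
      rw [LinearMap.mem_ker] at hb
      let y : V → ZMod 2 := fun v => if h : v ∈ facesVerts Z then b ⟨v, h⟩ else 0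
      have hedge : ∀ u v, s(u, v) ∈ Z.sup id → y u = y v := by
        intro u v he
        have hadj : P.graph.Adj u v := by
          obtain ⟨f, hf, hef⟩ := Finset.mem_sup.1 he
          exact face_adj P (Finset.mem_sdiff.1 hf).1 hef
        have h1 := congrFun hb ⟨s(u, v), he⟩
        simp only [hL, Matrix.mulVecLin_apply, Matrix.mulVec, dotProduct, D1, Matrix.of_apply,
          Matrix.transpose_apply, Pi.zero_apply] at h1
        have h2 : ∑ k ∈ facesVerts Z, (if k ∈ s(u, v) then (1 : ZMod 2) else 0) * y k = 0 := by
          refine Eq.trans ?_ h1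
          rw [← Finset.sum_coe_sort (facesVerts Z)
            (fun k => (if k ∈ s(u, v) then (1 : ZMod 2) else 0) * y k)]
          apply Finset.sum_congr rfl
          rintro ⟨k, hk⟩ -
          simp [y, hk]
        simp only [ite_mul, one_mul, zero_mul] at h2
        rw [← Finset.sum_filter] at h2
        have : (facesVerts Z).filter (fun k => k ∈ s(u, v)) = {u, v} := by
          ext k
          simp only [Finset.mem_filter, Finset.mem_insert, Finset.mem_singleton, Sym2.mem_iff]
          constructor
          · exact fun h => h.2
          · rintro h
            refine ⟨?_, h⟩
            rw [facesVerts, mem_edgeVerts]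
            exact ⟨_, he, by simpa using h⟩
        rw [this, Finset.sum_pair hadj.ne] at h2
        exact CharTwo.add_eq_zero.1 h2
      have hbd : ∀ e f g, f ∈ P.faces → g ∈ P.faces → e ∈ f → e ∈ g → f ∉ B.inFaces →
          g ∈ B.inFaces → e ∈ c.edges := by
        intro e f g hf hg hef heg hfB hgB
        have : e ∈ c.edges.toFinset := by
          rw [hce, Finset.mem_filter]
          refine ⟨Finset.mem_sup.2 ⟨g, hgB, heg⟩, ?_⟩
          obtain ⟨g', hg', hg'f, heg', hall⟩ := other_face P hf hef
          have hgg : g = g' := (hall g hg heg).resolve_left fun h => hfB (h ▸ hgB)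
          subst hgg
          rw [Finset.card_eq_one]
          refine ⟨g, ?_⟩
          ext k
          simp only [Finset.mem_filter, Finset.mem_singleton]
          constructor
          · rintro ⟨h1, h2⟩
            exact (hall k (B.subFaces h1) h2).resolve_left fun h => hfB (h ▸ h1)
          · rintro rfl
            exact ⟨hgB, heg⟩
        simpa using this
      have hcyc : ∀ v ∈ c.support, y v = y w := by
        apply const_walk
        intro u v huv
        apply hedge
        have : s(u, v) ∈ c.edges.toFinset := by simpa using huv
        rw [hce, Finset.mem_filter] at this
        obtain ⟨h1, h2⟩ := this
        obtain ⟨g, hg, heg⟩ := Finset.mem_sup.1 h1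
        obtain ⟨g', hg', hg'g, heg', -⟩ := other_face P (B.subFaces hg) heg
        refine Finset.mem_sup.2 ⟨g', ?_, heg'⟩
        rw [hZ, Finset.mem_sdiff]
        refine ⟨hg', fun hB => hg'g ?_⟩
        obtain ⟨k, hk⟩ := Finset.card_eq_one.1 h2
        have e1 : g ∈ ({k} : Finset _) := hk ▸ Finset.mem_filter.2 ⟨hg, heg⟩
        have e2 : g' ∈ ({k} : Finset _) := hk ▸ Finset.mem_filter.2 ⟨hB, heg'⟩
        rw [Finset.mem_singleton] at e1 e2
        rw [e1, e2]
      have hfc : ∀ f ∈ Z, ∀ u ∈ edgeVerts f, ∀ v ∈ edgeVerts f, y u = y v := by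
        intro f hf u hu v hv
        exact const_face y (Finset.mem_sdiff.1 hf).1
          (fun a b hab => hedge a b (Finset.mem_sup.2 ⟨f, hf, hab⟩)) hu hv
      have hX : ∀ f ∈ P.faces, ∀ g ∈ P.faces,
          (f ∈ Z ∧ ∃ v ∈ edgeVerts f, y v ≠ y w) = (g ∈ Z ∧ ∃ v ∈ edgeVerts g, y v ≠ y w) := by
        apply dual_conn hP (fun f => f ∈ Z ∧ ∃ v ∈ edgeVerts f, y v ≠ y w)
        have half : ∀ f ∈ P.faces, ∀ g ∈ P.faces, ∀ e ∈ f, e ∈ g →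
            (f ∈ Z ∧ ∃ v ∈ edgeVerts f, y v ≠ y w) → (g ∈ Z ∧ ∃ v ∈ edgeVerts g, y v ≠ y w) := by
          rintro f hf g hg e hef heg ⟨hfZ, v, hv, hvw⟩
          induction e with
          | _ a b =>
          have hne : y a ≠ y w := by
            rw [hfc f hfZ a (mem_edgeVerts_left hef) v hv]; exact hvw
          have hgB : g ∉ B.inFaces := fun hgB => by
            have := hbd _ f g hf hg hef heg (Finset.mem_sdiff.1 hfZ).2 hgB
            exact hne (hcyc a (c.fst_mem_support_of_mem_edges this))
          exact ⟨Finset.mem_sdiff.2 ⟨hg, hgB⟩, a, mem_edgeVerts_left heg, hne⟩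
        intro f hf g hg e hef heg
        exact propext ⟨half f hf g hg e hef heg, half g hg f hf e heg hef⟩
      obtain ⟨f0, hf0⟩ := B.nonempty
      rw [Submodule.mem_span_singleton]
      refine ⟨y w, ?_⟩
      ext ⟨v, hv⟩
      obtain ⟨f, hf, hvf⟩ := mem_facesVerts.1 hv
      have h1 : ¬(f ∈ Z ∧ ∃ v ∈ edgeVerts f, y v ≠ y w) := by
        rw [hX f (Finset.mem_sdiff.1 hf).1 f0 (B.subFaces hf0)]
        exact fun h => (Finset.mem_sdiff.1 h.1).2 hf0
      push Not at h1
      have := h1 hf v hvf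
      simp only [Pi.smul_apply, smul_eq_mul, mul_one]
      rw [← this]
      simp [y, hv]
    exact (Submodule.finrank_mono hle).trans ((finrank_span_le_card _).trans (by simp))
  have hrn := LinearMap.finrank_range_add_finrank_ker L
  have hd : Module.finrank (ZMod 2) (facesVerts Z → ZMod 2) = (facesVerts Z).card := by simp
  have hrk : (D1 (facesVerts Z) (Z.sup id)).transpose.rank =
    Module.finrank (ZMod 2) (LinearMap.range L) := rfl
  have hrn' := hrn.trans hd
  omega

theorem complement_bound (hP : IsFullerene P) (B : Fragment P) :
    (facesVerts (P.faces \ B.inFaces)).card + (P.faces \ B.inFaces).card ≤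
      ((P.faces \ B.inFaces).sup id).card + 1 := by
  obtain ⟨f0, hf0⟩ := B.nonempty
  have h1 := rank_D1 hP B
  have h2 := rank_D2 hP (Z := P.faces \ B.inFaces) Finset.sdiff_subset (B.subFaces hf0)
    (fun h => (Finset.mem_sdiff.1 h).2 hf0)
  have h3 := Matrix.rank_add_rank_le_card_of_mul_eq_zero
    (D1_mul_D2 (P := P) (Z := P.faces \ B.inFaces) Finset.sdiff_subset)
  rw [Fintype.card_coe] at h3
  omega

end Topology
section Counting

variable {P : PlaneGraph V} {S : Finset (Finset (Sym2 V))}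

theorem two_card_edges : 2 * (P.faces.sup id).card = ∑ f ∈ P.faces, f.card := by
  have h := Finset.sum_card_bipartiteAbove_eq_sum_card_bipartiteBelow
    (s := P.faces.sup id) (t := P.faces) (fun e f => e ∈ f)
  have h1 : ∀ e ∈ P.faces.sup id, (Finset.bipartiteAbove (fun e f => e ∈ f) P.faces e).card = 2 := by
    intro e he
    obtain ⟨f, hf, hef⟩ := Finset.mem_sup.1 he
    exact P.edge_faces e (P.face_edges f hf e hef)
  have h2 : ∀ f ∈ P.faces,
      (Finset.bipartiteBelow (fun e f => e ∈ f) (P.faces.sup id) f).card = f.card := by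
    intro f hf
    congr 1
    ext e
    simp only [Finset.bipartiteBelow, Finset.mem_filter, Finset.mem_sup, id]
    exact ⟨fun h => h.2, fun h => ⟨⟨f, hf, h⟩, h⟩⟩
  have h3 := (Finset.sum_congr rfl h1).symm.trans (h.trans (Finset.sum_congr rfl h2))
  rw [Finset.sum_const, smul_eq_mul] at h3
  rw [← h3, mul_comm]

open Classical in
theorem sum_innc (hS : S ⊆ P.faces) :
    ∑ p ∈ S, innc P S p = 2 * ((P.faces.sup id).filter fun e => Inner P S e).card := by
  have h := Finset.sum_card_bipartiteAbove_eq_sum_card_bipartiteBelow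
    (s := (P.faces.sup id).filter fun e => Inner P S e) (t := S) (fun e f => e ∈ f)
  have h1 : ∀ e ∈ (P.faces.sup id).filter fun e => Inner P S e,
      (Finset.bipartiteAbove (fun e f => e ∈ f) S e).card = 2 := by
    intro e he
    obtain ⟨he, hi⟩ := Finset.mem_filter.1 he
    obtain ⟨f, hf, hef⟩ := Finset.mem_sup.1 he
    rw [← P.edge_faces e (P.face_edges f hf e hef)]
    congr 1
    ext k
    simp only [Finset.bipartiteAbove, Finset.mem_filter]
    exact ⟨fun h => ⟨hS h.1, h.2⟩, fun h => ⟨hi k h.1 h.2, h.2⟩⟩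
  have h2 : ∀ f ∈ S, (Finset.bipartiteBelow (fun e f => e ∈ f)
      ((P.faces.sup id).filter fun e => Inner P S e) f).card = innc P S f := by
    intro f hf
    rw [innc]
    congr 1
    ext e
    simp only [Finset.bipartiteBelow, Finset.mem_filter, Finset.mem_sup, id]
    exact ⟨fun h => ⟨h.2, h.1.2⟩, fun h => ⟨⟨⟨f, hS hf, h.1⟩, h.2⟩, h.1⟩⟩
  have h3 := (Finset.sum_congr rfl h1).symm.trans (h.trans (Finset.sum_congr rfl h2))
  rw [Finset.sum_const, smul_eq_mul] at h3
  rw [← h3, mul_comm]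

theorem three_faces (hP : IsFullerene P) (v : V) :
    (P.faces.filter fun f => v ∈ edgeVerts f).card = 3 := by
  obtain ⟨p, hp, hv⟩ := vert_face hP v
  obtain ⟨a, b, hab, h⟩ := face_deg P hp hv
  obtain ⟨c, q, r, K⟩ := exists_corner P hP hp hab ((h a).2 (Or.inl rfl)) ((h b).2 (Or.inr rfl))
  rw [Finset.card_eq_three]
  refine ⟨p, q, r, ?_, ?_, ?_, ?_⟩
  · rintro rfl; exact K.cp K.cq
  · rintro rfl; exact K.cp K.cr
  · rintro rfl; exact K.bq K.br
  · ext k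
    simp only [Finset.mem_filter, Finset.mem_insert, Finset.mem_singleton]
    constructor
    · rintro ⟨h1, h2⟩; exact K.all k h1 h2
    · rintro (rfl | rfl | rfl)
      · exact ⟨hp, hv⟩
      · exact ⟨K.hq, mem_edgeVerts_left K.aq⟩
      · exact ⟨K.hr, mem_edgeVerts_left K.br⟩

open Classical in
theorem sum_intc (hP : IsFullerene P) (hS : S ⊆ P.faces) :
    ∑ p ∈ S, intc P S p = 3 * (Finset.univ.filter fun v => IntV P S v).card := by
  have h := Finset.sum_card_bipartiteAbove_eq_sum_card_bipartiteBelow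
    (s := Finset.univ.filter fun v => IntV P S v) (t := S) (fun v f => v ∈ edgeVerts f)
  have h1 : ∀ v ∈ Finset.univ.filter fun v => IntV P S v,
      (Finset.bipartiteAbove (fun v f => v ∈ edgeVerts f) S v).card = 3 := by
    intro v hv
    have hi := (Finset.mem_filter.1 hv).2
    rw [← three_faces hP v]
    congr 1
    ext k
    simp only [Finset.bipartiteAbove, Finset.mem_filter]
    exact ⟨fun h => ⟨hS h.1, h.2⟩, fun h => ⟨hi k h.1 h.2, h.2⟩⟩
  have h2 : ∀ f ∈ S, (Finset.bipartiteBelow (fun v f => v ∈ edgeVerts f)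
      (Finset.univ.filter fun v => IntV P S v) f).card = intc P S f := by
    intro f hf
    rw [intc]
    congr 1
    ext e
    simp only [Finset.bipartiteBelow, Finset.mem_filter, Finset.mem_univ, true_and]
    exact and_comm
  have h3 := (Finset.sum_congr rfl h1).symm.trans (h.trans (Finset.sum_congr rfl h2))
  rw [Finset.sum_const, smul_eq_mul] at h3
  rw [← h3, mul_comm]

theorem six_le (hP : IsFullerene P) (B : Fragment P) :
    6 ≤ ∑ p ∈ B.inFaces, charge P B.inFaces p := by
  classical
  have h1 := complement_bound hP B
  have h2 := two_card_edges (P := P)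
  have h3 := P.euler
  have h4 := sum_innc B.subFaces
  have h5 := sum_intc hP B.subFaces
  have h6 : (P.faces \ B.inFaces).card + B.inFaces.card = P.faces.card :=
    Finset.card_sdiff_add_card_eq_card B.subFaces
  have h7 : ((P.faces.sup id).filter fun e => Inner P B.inFaces e).card +
      ((P.faces \ B.inFaces).sup id).card = (P.faces.sup id).card := by
    rw [← Finset.card_filter_add_card_filter_not (s := P.faces.sup id)
      (fun e => Inner P B.inFaces e)]
    congr 1
    refine congrArg Finset.card ?_
    ext e
    rw [Finset.mem_filter]
    simp only [Finset.mem_sup, id, Finset.mem_sdiff, Inner]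
    push Not
    constructor
    · rintro ⟨f, ⟨h1, h2⟩, h3⟩; exact ⟨⟨f, h1, h3⟩, f, h1, h3, h2⟩
    · rintro ⟨-, f, h1, h3, h2⟩; exact ⟨f, ⟨h1, h2⟩, h3⟩
  have h8 : (Finset.univ.filter fun v => IntV P B.inFaces v).card +
      (facesVerts (P.faces \ B.inFaces)).card = Fintype.card V := by
    rw [← Finset.card_univ, ← Finset.card_filter_add_card_filter_not (s := Finset.univ)
      (fun v => IntV P B.inFaces v)]
    congr 1
    refine congrArg Finset.card ?_
    ext v
    rw [Finset.mem_filter]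
    simp only [mem_facesVerts, Finset.mem_univ, true_and, Finset.mem_sdiff, IntV]
    push Not
    constructor
    · rintro ⟨f, ⟨h1, h2⟩, h3⟩; exact ⟨f, h1, h3, h2⟩
    · rintro ⟨f, h1, h3, h2⟩; exact ⟨f, ⟨h1, h2⟩, h3⟩
  have h9 : ∑ p ∈ B.inFaces, charge P B.inFaces p = 6 * (B.inFaces.card : ℤ) +
      2 * ((∑ p ∈ B.inFaces, intc P B.inFaces p : ℕ) : ℤ) -
      3 * ((∑ p ∈ B.inFaces, innc P B.inFaces p : ℕ) : ℤ) := by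
    simp only [charge, Finset.sum_sub_distrib, Finset.sum_add_distrib, ← Finset.mul_sum,
      Finset.sum_const, nsmul_eq_mul]
    push_cast
    ring
  rw [h9, h4, h5]
  push_cast
  omega

end Counting

section Main

variable {P : PlaneGraph V}

theorem deg_three (hP : IsFullerene P) {E : Finset (Sym2 V)}
    (hE : ∀ e ∈ E, e ∈ P.graph.edgeSet) {v : V} (h : ∀ x, P.graph.Adj v x → s(v, x) ∈ E) :
    deg E v = 3 := by
  rw [deg, ← hP.cubic v]
  have : ((E.filter fun e => v ∈ e : Finset (Sym2 V)) : Set (Sym2 V)) =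
      (fun x => s(v, x)) '' P.graph.neighborSet v := by
    ext e
    simp only [Finset.coe_filter, Set.mem_ofPred_eq, Set.mem_image, SimpleGraph.mem_neighborSet]
    constructor
    · rintro ⟨he, x, rfl⟩
      exact ⟨x, by simpa using hE _ he, rfl⟩
    · rintro ⟨x, hx, rfl⟩
      exact ⟨h x hx, by simp⟩
  rw [← Set.ncard_coe_finset, this, Set.ncard_image_of_injective]
  intro x y hxy
  simp at hxy
  grind

theorem inner_of_two {S : Finset (Finset (Sym2 V))} {f g : Finset (Sym2 V)} (hf : f ∈ P.faces)
    (hg : g ∈ P.faces) (hfS : f ∈ S) (hgS : g ∈ S) (hfg : g ≠ f) {e : Sym2 V} (h1 : e ∈ f)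
    (h2 : e ∈ g) : Inner P S e := by
  intro k hk hek
  obtain ⟨g', hg', hg'f, heg', hall⟩ := other_face P hf h1
  have e1 := (hall g hg h2).resolve_left hfg
  rcases hall k hk hek with rfl | rfl
  · exact hfS
  · exact e1 ▸ hgS

theorem main_aux (P : PlaneGraph V) (hP : IsFullerene P) (B : Fragment P)
    (hB : IsPentagonalFragment B)
    (hγ : ∀ p ∈ B.inFaces, 2 ≤ pentAdjCount B p) :
    ¬IsExtremalSub P B.edges := by
  classical
  rintro ⟨H, ⟨⟨hH, hdis, M, hME, hmat, hmh, hcov⟩, -⟩, hcard⟩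
  have hE : ∀ e ∈ B.edges, ∃ g ∈ B.inFaces, e ∈ g := fun e he => Finset.mem_sup.1 he
  have hEg : ∀ e ∈ B.edges, e ∈ P.graph.edgeSet := fun e he => by
    obtain ⟨g, hg, heg⟩ := hE e he
    exact P.face_edges g (B.subFaces hg) e heg
  have hpf : ∀ f, f ∈ pentFaces P B.edges ↔ f ∈ P.faces ∧ f.card = 5 ∧ f ⊆ B.edges := fun f => by
    simp [pentFaces]
  have C : Cfg P (pentFaces P B.edges) H M :=
    { full := hP
      sf := fun p hp => ((hpf p).1 hp).1
      s5 := fun p hp => ((hpf p).1 hp).2.1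
      hf := fun h hh => (hH h hh).1
      h6 := fun h hh => (hH h hh).2.1
      dis := hdis
      mat := hmat
      mg := fun e he => hEg e (hME he)
      mh := hmh
      cov := by
        intro v hv p hp q hq hpq hvp hvq
        rw [hpf] at hp hq
        refine hcov v ?_ (deg_three hP hEg fun x hx => ?_) hv
        · obtain ⟨e, he, h⟩ := mem_edgeVerts.1 hvp
          exact mem_edgeVerts.2 ⟨e, hp.2.2 he, h⟩
        · rcases cover_two hP hp.1 hq.1 hpq hvp hvq hx with h | h
          · exact hp.2.2 h
          · exact hq.2.2 h }
  have T : Tight P (pentFaces P B.edges) H M := by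
    refine tight_of_card C (Uset B.edges H) ?_ hcard
    intro p hp v hv hvH
    obtain ⟨e, he, h⟩ := mem_edgeVerts.1 hv
    exact Finset.mem_sdiff.2 ⟨mem_edgeVerts.2 ⟨e, ((hpf p).1 hp).2.2 he, h⟩, hvH⟩
  have hsub : B.inFaces ⊆ pentFaces P B.edges := fun f hf =>
    (hpf f).2 ⟨B.subFaces hf, hB f hf, fun e he => Finset.mem_sup.2 ⟨f, hf, he⟩⟩
  have hS : pentFaces P B.edges = B.inFaces := by
    refine Finset.Subset.antisymm (fun f hf => ?_) hsub
    by_contra hfB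
    obtain ⟨y, c, d, d', c', h, -, ⟨k, hk, hck⟩, -⟩ := T.normal hf
    have hcf : s(c, d) ∈ f := h.rot.edge
    have hf' := (hpf f).1 hf
    obtain ⟨g, hg, heg⟩ := hE _ (hf'.2.2 hcf)
    exact C.not_inner hk hck (inner_of_two hf'.1 (B.subFaces hg) hf (hsub hg)
      (fun h => hfB (h ▸ hg)) hcf heg)
  rw [hS] at T
  have hi : ∀ p ∈ B.inFaces, 2 ≤ innc P B.inFaces p := by
    intro p hp
    have h2 := hγ p hp
    rw [pentAdjCount] at h2
    obtain ⟨q1, hq1, q2, hq2, hne⟩ := Finset.one_lt_card.1 (by omega :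
      1 < (B.inFaces.filter fun q => q ≠ p ∧ (q ∩ p).Nonempty).card)
    simp only [Finset.mem_filter] at hq1 hq2
    obtain ⟨hq1, hq1p, e1, he1⟩ := hq1
    obtain ⟨hq2, hq2p, e2, he2⟩ := hq2
    rw [Finset.mem_inter] at he1 he2
    have i1 := inner_of_two (B.subFaces hp) (B.subFaces hq1) hp hq1 hq1p he1.2 he1.1
    have i2 := inner_of_two (B.subFaces hp) (B.subFaces hq2) hp hq2 hq2p he2.2 he2.1
    rw [innc]
    refine Nat.succ_le_of_lt (Finset.one_lt_card.2 ⟨e1, Finset.mem_filter.2 ⟨he1.2, i1⟩, e2,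
      Finset.mem_filter.2 ⟨he2.2, i2⟩, ?_⟩)
    rintro rfl
    obtain ⟨g', hg', hg'f, heg', hall⟩ := other_face P (B.subFaces hp) he1.2
    exact hne (((hall q1 (B.subFaces hq1) he1.1).resolve_left hq1p).trans
      ((hall q2 (B.subFaces hq2) he2.1).resolve_left hq2p).symm)
  have := T.sum_charge hi
  have := six_le hP B
  omega

end Main
/-- Lemma 3.7. Let `B` be a pentagonal fragment of a fullerene graph
with `γ(B) ≥ 2`. Then `B` is not extremal. -/
theorem statement_10 (P : PlaneGraph V) (hP : IsFullerene P) (B : Fragment P)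
    (hB : IsPentagonalFragment B)
    (hγ : ∀ p ∈ B.inFaces, 2 ≤ pentAdjCount B p) :
    ¬IsExtremalSub P B.edges := by
  exact main_aux P hP B hB hγ

end FG
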